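/- For N ≥ 1 let W_N be the (finite, nonempty) set of N-step self-avoiding walks in ℤ²: functions h : {0,1,…,N} → ℤ² with h(0) = (0,0), ‖h(i+1) − h(i)‖₁ = 1 for all 0 ≤ i < N, and h injective. Let E_N denote expectation with respect to the uniform probability measure on W_N, and let ‖·‖ denote the Euclidean norm on ℝ². Then for every real p ≥ 1, lim_{N→∞} N^{−1} (E_N[‖h(N)‖^p])^{1/p} = 0: the endpoint of the self-avoiding walk is sublinear in the number of steps. -/

import Mathlib

open scoped Classical
open Filter Topology

noncomputable section

/-- A bounding box for `N`-step walks: functions `{0,…,N} → [-N,N]² ⊆ ℤ²` (every `N`-step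
nearest-neighbour walk started at the origin takes values there). -/
def walkBox (N : ℕ) : Finset (Fin (N + 1) → ℤ × ℤ) :=
  Fintype.piFinset fun _ => (Finset.Icc (-(N : ℤ)) N) ×ˢ (Finset.Icc (-(N : ℤ)) N)

/-- `W_N`: the set of `N`-step self-avoiding walks in `ℤ²`, i.e. injective functions
`h : {0,…,N} → ℤ²` with `h 0 = 0` and `‖h(i+1) - h(i)‖₁ = 1` for all `i < N`. -/
def SAW (N : ℕ) : Finset (Fin (N + 1) → ℤ × ℤ) :=
  (walkBox N).filter fun h =>
    h 0 = (0, 0) ∧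
    (∀ i : Fin N,
      |(h i.succ).1 - (h i.castSucc).1| + |(h i.succ).2 - (h i.castSucc).2| = 1) ∧
    Function.Injective h

/-- The Euclidean norm of the endpoint `h(N)` of a walk. -/
def endNorm (N : ℕ) (h : Fin (N + 1) → ℤ × ℤ) : ℝ :=
  Real.sqrt (((h (Fin.last N)).1 : ℝ) ^ 2 + ((h (Fin.last N)).2 : ℝ) ^ 2)

/-- `E_N[‖h(N)‖^p]`: the mean `p`-th power of the endpoint displacement under the uniform
measure on `W_N`. -/
def meanEndNorm (N : ℕ) (p : ℝ) : ℝ :=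
  (∑ h ∈ SAW N, endNorm N h ^ p) / (SAW N).card

end

namespace SAWalk

open scoped ENNReal

/-! ### Words of unit steps -/

/-- The four unit steps of `ℤ²`. -/
inductive Step
  | east | west | north | south
  deriving DecidableEq

instance : Fintype Step :=
  ⟨{Step.east, Step.west, Step.north, Step.south}, fun a => by cases a <;> simp⟩

/-- Horizontal displacement of a step. -/
def Step.dx : Step → ℤ
  | east => 1
  | west => -1
  | _ => 0

/-- Vertical displacement of a step. -/
def Step.dy : Step → ℤ
  | north => 1
  | south => -1
  | _ => 0

/-- Reflection in the vertical axis. -/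
def Step.flip : Step → Step
  | east => west
  | west => east
  | a => a

/-- Reflection in the horizontal axis. -/
def Step.mirror : Step → Step
  | north => south
  | south => north
  | a => a

/-- Rotation by a right angle. -/
def Step.rot : Step → Step
  | east => north
  | north => west
  | west => south
  | south => east

/-- Rotation by a right angle, clockwise. -/
def Step.unrot : Step → Step
  | east => south
  | north => east
  | west => north
  | south => west

/-- Rotation by two right angles. -/
def Step.neg : Step → Step
  | east => west
  | north => south
  | west => east
  | south => north

/-- A lattice walk, given by its sequence of steps. -/
abbrev Walk := List Step

/-- Horizontal displacement of a walk. -/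
def X (w : Walk) : ℤ := (w.map Step.dx).sum

/-- Vertical displacement of a walk. -/
def Y (w : Walk) : ℤ := (w.map Step.dy).sum

@[simp] lemma X_nil : X [] = 0 := rfl
@[simp] lemma Y_nil : Y [] = 0 := rfl
@[simp] lemma X_cons (a : Step) (w : Walk) : X (a :: w) = a.dx + X w := by simp [X]
@[simp] lemma Y_cons (a : Step) (w : Walk) : Y (a :: w) = a.dy + Y w := by simp [Y]
@[simp] lemma X_append (u v : Walk) : X (u ++ v) = X u + X v := by simp [X]
@[simp] lemma Y_append (u v : Walk) : Y (u ++ v) = Y u + Y v := by simp [Y]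
@[simp] lemma X_reverse (u : Walk) : X u.reverse = X u := by simp [X, List.sum_reverse]
@[simp] lemma Y_reverse (u : Walk) : Y u.reverse = Y u := by simp [Y, List.sum_reverse]

@[simp] lemma X_flip (w : Walk) : X (w.map Step.flip) = -X w := by
  induction w with
  | nil => rfl
  | cons a w ih => cases a <;> simp [ih, Step.flip, Step.dx] <;> ring

@[simp] lemma Y_flip (w : Walk) : Y (w.map Step.flip) = Y w := by
  induction w with
  | nil => rfl
  | cons a w ih => cases a <;> simp [ih, Step.flip, Step.dy]

@[simp] lemma X_mirror (w : Walk) : X (w.map Step.mirror) = X w := by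
  induction w with
  | nil => rfl
  | cons a w ih => cases a <;> simp [ih, Step.mirror, Step.dx]

@[simp] lemma Y_mirror (w : Walk) : Y (w.map Step.mirror) = -Y w := by
  induction w with
  | nil => rfl
  | cons a w ih => cases a <;> simp [ih, Step.mirror, Step.dy] <;> ring

@[simp] lemma X_rot (w : Walk) : X (w.map Step.rot) = -Y w := by
  induction w with
  | nil => rfl
  | cons a w ih => cases a <;> simp [ih, Step.rot, Step.dx, Step.dy] <;> ring

@[simp] lemma Y_rot (w : Walk) : Y (w.map Step.rot) = X w := by
  induction w with
  | nil => rfl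
  | cons a w ih => cases a <;> simp [ih, Step.rot, Step.dx, Step.dy]

@[simp] lemma X_unrot (w : Walk) : X (w.map Step.unrot) = Y w := by
  induction w with
  | nil => rfl
  | cons a w ih => cases a <;> simp [ih, Step.unrot, Step.dx, Step.dy]

@[simp] lemma Y_unrot (w : Walk) : Y (w.map Step.unrot) = -X w := by
  induction w with
  | nil => rfl
  | cons a w ih => cases a <;> simp [ih, Step.unrot, Step.dx, Step.dy] <;> ring

@[simp] lemma X_neg (w : Walk) : X (w.map Step.neg) = -X w := by
  induction w with
  | nil => rfl
  | cons a w ih => cases a <;> simp [ih, Step.neg, Step.dx] <;> ring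

@[simp] lemma Y_neg (w : Walk) : Y (w.map Step.neg) = -Y w := by
  induction w with
  | nil => rfl
  | cons a w ih => cases a <;> simp [ih, Step.neg, Step.dy] <;> ring

@[simp] lemma map_flip_flip (w : Walk) : (w.map Step.flip).map Step.flip = w := by
  induction w with
  | nil => rfl
  | cons a w ih => cases a <;> simp_all [Step.flip]

@[simp] lemma map_mirror_mirror (w : Walk) : (w.map Step.mirror).map Step.mirror = w := by
  induction w with
  | nil => rfl
  | cons a w ih => cases a <;> simp_all [Step.mirror]

lemma injective_flip : Function.Injective Step.flip := by
  intro a b h; cases a <;> cases b <;> simp_all [Step.flip]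

lemma injective_rot : Function.Injective Step.rot := by
  intro a b h; cases a <;> cases b <;> simp_all [Step.rot]

lemma injective_unrot : Function.Injective Step.unrot := by
  intro a b h; cases a <;> cases b <;> simp_all [Step.unrot]

lemma abs_X_le (w : Walk) : |X w| ≤ w.length := by
  induction w with
  | nil => simp
  | cons a w ih =>
    rw [abs_le] at *
    cases a <;> simp [Step.dx] <;> omega

lemma abs_Y_le (w : Walk) : |Y w| ≤ w.length := by
  induction w with
  | nil => simp
  | cons a w ih =>
    rw [abs_le] at *
    cases a <;> simp [Step.dy] <;> omega

lemma X_le_length (w : Walk) : X w ≤ w.length := (abs_le.1 (abs_X_le w)).2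

lemma prefix_append_cases {α : Type*} {u a b : List α} (h : u <+: a ++ b) :
    u <+: a ∨ ∃ v, v <+: b ∧ v ≠ [] ∧ u = a ++ v := by
  obtain ⟨t, ht⟩ := h
  rcases List.append_eq_append_iff.1 ht with ⟨as, h1, _⟩ | ⟨bs, h1, h2⟩
  · exact Or.inl ⟨as, h1.symm⟩
  · rcases eq_or_ne bs [] with rfl | hb
    · exact Or.inl (by simp [h1])
    · exact Or.inr ⟨bs, ⟨t, h2.symm⟩, hb, h1⟩

lemma suffix_append_cases {α : Type*} {u a b : List α} (h : u <:+ a ++ b) :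
    u <:+ b ∨ ∃ v, v <:+ a ∧ v ≠ [] ∧ u = v ++ b := by
  obtain ⟨t, ht⟩ := h
  rcases List.append_eq_append_iff.1 ht with ⟨as, h1, h2⟩ | ⟨bs, h1, h2⟩
  · rcases eq_or_ne as [] with rfl | hb
    · exact Or.inl (by simp [h2])
    · exact Or.inr ⟨as, ⟨t, h1.symm⟩, hb, h2⟩
  · exact Or.inl ⟨bs, h2.symm⟩

/-! ### Self-avoiding words and bridges -/

/-- A word is self-avoiding if no nonempty contiguous subword has zero displacement. -/
def SelfAvoiding (w : Walk) : Prop :=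
  ∀ u, u <:+: w → u ≠ [] → ¬(X u = 0 ∧ Y u = 0)

lemma SelfAvoiding.of_isInfix {u w : Walk} (h : SelfAvoiding w) (hu : u <:+: w) : SelfAvoiding u :=
  fun v hv hn => h v (hv.trans hu) hn

lemma SelfAvoiding.map {f : Step → Step}
    (hf : ∀ u : Walk, X (u.map f) = 0 ∧ Y (u.map f) = 0 → X u = 0 ∧ Y u = 0) {w : Walk}
    (h : SelfAvoiding w) : SelfAvoiding (w.map f) := by
  intro u hu hn h0
  obtain ⟨v, hv, rfl⟩ := List.infix_map_iff.1 hu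
  exact h v hv (by rintro rfl; simp at hn) (hf v h0)

lemma SelfAvoiding.flip {w : Walk} (h : SelfAvoiding w) : SelfAvoiding (w.map Step.flip) :=
  h.map fun u hu => by simpa using hu

lemma SelfAvoiding.mirror {w : Walk} (h : SelfAvoiding w) : SelfAvoiding (w.map Step.mirror) :=
  h.map fun u hu => by simpa using hu

lemma SelfAvoiding.neg {w : Walk} (h : SelfAvoiding w) : SelfAvoiding (w.map Step.neg) :=
  h.map fun u hu => by simpa using hu

lemma SelfAvoiding.rot {w : Walk} (h : SelfAvoiding w) : SelfAvoiding (w.map Step.rot) :=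
  h.map fun u hu => by simpa [and_comm] using hu

lemma SelfAvoiding.unrot {w : Walk} (h : SelfAvoiding w) : SelfAvoiding (w.map Step.unrot) :=
  h.map fun u hu => by simpa [and_comm] using hu

lemma SelfAvoiding.reverse {w : Walk} (h : SelfAvoiding w) : SelfAvoiding w.reverse := by
  intro u hu hn h0
  refine h u.reverse ?_ (by simpa using hn) (by simpa using h0)
  rw [← List.reverse_infix]
  simpa using hu

lemma SelfAvoiding.append {a b : Walk} (ha : SelfAvoiding a) (hb : SelfAvoiding b)
    (h : ∀ u v, u <:+ a → v <+: b → u ≠ [] → v ≠ [] → ¬(X u + X v = 0 ∧ Y u + Y v = 0)) :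
    SelfAvoiding (a ++ b) := by
  intro w hw hn
  rcases List.infix_append_iff.1 hw with h1 | h1 | ⟨u, v, rfl, hu, hv⟩
  · exact ha w h1 hn
  · exact hb w h1 hn
  · rcases eq_or_ne u [] with rfl | hu0
    · exact hb _ (by simpa using hv.isInfix) hn
    rcases eq_or_ne v [] with rfl | hv0
    · exact ha _ (by simpa using hu.isInfix) hn
    simpa using h u v hu hv hu0 hv0

/-- A bridge: a self-avoiding word staying strictly to the right of its starting point and
weakly to the left of its endpoint. -/
structure Bridge (w : Walk) : Prop where
  sa : SelfAvoiding w
  pos : ∀ u, u <+: w → u ≠ [] → 0 < X u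
  nonneg : ∀ v, v <:+ w → 0 ≤ X v

lemma bridge_nil : Bridge [] where
  sa u hu hn := by simp at hu; exact absurd hu hn
  pos u hu hn := by simp at hu; exact absurd hu hn
  nonneg u hu := by simp at hu; simp [hu]

lemma Bridge.X_pos {w : Walk} (h : Bridge w) (hw : w ≠ []) : 0 < X w :=
  h.pos w (List.prefix_refl _) hw

lemma Bridge.X_nonneg {w : Walk} (h : Bridge w) : 0 ≤ X w := h.nonneg w (List.suffix_refl _)

lemma Bridge.append {a b : Walk} (ha : Bridge a) (hb : Bridge b) : Bridge (a ++ b) where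
  sa := ha.sa.append hb.sa fun u v hu hv _ hv0 h => by
    have := ha.nonneg u hu
    have := hb.pos v hv hv0
    omega
  pos u hu hn := by
    rcases prefix_append_cases hu with h | ⟨v, hv, hv0, rfl⟩
    · exact ha.pos u h hn
    · have := hb.pos v hv hv0
      have := ha.X_nonneg
      simp
      omega
  nonneg u hu := by
    rcases suffix_append_cases hu with h | ⟨v, hv, hv0, rfl⟩
    · exact hb.nonneg u h
    · have := ha.nonneg v hv
      have := hb.X_nonneg
      simp
      omega

lemma Bridge.mirror {w : Walk} (h : Bridge w) : Bridge (w.map Step.mirror) where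
  sa := h.sa.mirror
  pos u hu hn := by
    obtain ⟨v, hv, rfl⟩ := List.prefix_map_iff.1 hu
    simpa using h.pos v hv (by rintro rfl; simp at hn)
  nonneg u hu := by
    obtain ⟨v, hv, rfl⟩ := List.suffix_map_iff.1 hu
    simpa using h.nonneg v hv

/-- A prefix of a bridge is a bridge as soon as its endpoint is its rightmost point. -/
lemma Bridge.of_isPrefix {u w : Walk} (h : Bridge w) (hu : u <+: w)
    (hn : ∀ v, v <:+ u → 0 ≤ X v) : Bridge u :=
  ⟨h.sa.of_isInfix hu.isInfix, fun v hv => h.pos v (hv.trans hu), hn⟩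

lemma Bridge.of_suffix {u w : Walk} (h : Bridge w) (hu : u <:+ w)
    (hp : ∀ v, v <+: u → v ≠ [] → 0 < X v) : Bridge u :=
  ⟨h.sa.of_isInfix hu.isInfix, hp, fun v hv => h.nonneg v (hv.trans hu)⟩

/-! ### Irreducible bridges -/

/-- A nonempty bridge that is not a concatenation of two nonempty bridges. -/
structure Irr (w : Walk) : Prop where
  bridge : Bridge w
  ne_nil : w ≠ []
  irr : ∀ u v, w = u ++ v → Bridge u → Bridge v → u = [] ∨ v = []

lemma Irr.X_pos {w : Walk} (h : Irr w) : 0 < X w := h.bridge.X_pos h.ne_nil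

lemma Irr.mirror {w : Walk} (h : Irr w) : Irr (w.map Step.mirror) where
  bridge := h.bridge.mirror
  ne_nil := by simpa using h.ne_nil
  irr u v huv hu hv := by
    have := h.irr (u.map Step.mirror) (v.map Step.mirror)
      (by rw [← List.map_append, ← huv, map_mirror_mirror]) hu.mirror hv.mirror
    simpa using this

lemma irr_east : Irr [Step.east] where
  bridge :=
    { sa := fun u hu hn => by
        rcases (List.infix_singleton_iff _ _).1 hu with rfl | rfl
        · exact absurd rfl hn
        · simp [Step.dx]
      pos := fun u hu hn => by
        rcases (List.infix_singleton_iff _ _).1 hu.isInfix with rfl | rfl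
        · exact absurd rfl hn
        · simp [Step.dx]
      nonneg := fun u hu => by
        rcases (List.infix_singleton_iff _ _).1 hu.isInfix with rfl | rfl <;> simp [Step.dx] }
  ne_nil := by simp
  irr u v h _ _ := by
    rcases List.append_eq_singleton_iff.1 h.symm with h | h <;> simp [h]

/-- The type of irreducible bridges. -/
abbrev I := {w : Walk // Irr w}

/-- Concatenation of a list of irreducible bridges. -/
def cat (l : List I) : Walk := (l.map Subtype.val).flatten

@[simp] lemma cat_nil : cat [] = [] := rfl
@[simp] lemma cat_cons (b : I) (l : List I) : cat (b :: l) = b.1 ++ cat l := rfl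
@[simp] lemma cat_append (k l : List I) : cat (k ++ l) = cat k ++ cat l := by simp [cat]

lemma bridge_cat (l : List I) : Bridge (cat l) := by
  induction l with
  | nil => exact bridge_nil
  | cons b l ih => exact b.2.bridge.append ih

lemma length_le_X_cat (l : List I) : (l.length : ℤ) ≤ X (cat l) := by
  induction l with
  | nil => simp
  | cons b l ih => have := b.2.X_pos; simp; omega

lemma exists_cat {w : Walk} (h : Bridge w) : ∃ l, cat l = w := by
  induction hn : w.length using Nat.strong_induction_on generalizing w with
  | _ n ih =>
    by_cases hw : w = []
    · exact ⟨[], hw.symm⟩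
    by_cases hi : Irr w
    · exact ⟨[⟨w, hi⟩], by simp⟩
    · have : ∃ u v, w = u ++ v ∧ Bridge u ∧ Bridge v ∧ u ≠ [] ∧ v ≠ [] := by
        by_contra hc
        push Not at hc
        exact hi ⟨h, hw, fun u v e hu hv => by
          by_contra h'
          push Not at h'
          exact h'.2 (hc u v e hu hv h'.1)⟩
      obtain ⟨u, v, rfl, hu, hv, hu0, hv0⟩ := this
      have h1 := List.length_pos_of_ne_nil hu0
      have h2 := List.length_pos_of_ne_nil hv0
      simp only [List.length_append] at hn
      obtain ⟨k, rfl⟩ := ih _ (by omega) hu rfl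
      obtain ⟨l, rfl⟩ := ih _ (by omega) hv rfl
      exact ⟨k ++ l, by simp⟩

lemma irr_prefix_unique {b c r s : Walk} (hb : Irr b) (hc : Irr c) (hr : Bridge r)
    (h : b ++ r = c ++ s) {a : Walk} (hca : c = b ++ a) : a = [] := by
  subst hca
  have hra : r = a ++ s := by simpa using h
  have ha : Bridge a := hc.bridge.of_suffix ⟨b, rfl⟩ fun v hv =>
    hr.pos v (hv.trans ⟨s, hra.symm⟩)
  exact (hc.irr b a rfl hb.bridge ha).resolve_left hb.ne_nil

lemma cat_injective : Function.Injective cat := by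
  intro k
  induction k with
  | nil =>
    intro l h
    cases l with
    | nil => rfl
    | cons b l => exact absurd (List.append_eq_nil_iff.1 h.symm).1 b.2.ne_nil
  | cons b k ih =>
    intro l h
    cases l with
    | nil => exact absurd (List.append_eq_nil_iff.1 h).1 b.2.ne_nil
    | cons c l =>
      simp only [cat_cons] at h
      have hbc : b.1 = c.1 := by
        rcases List.append_eq_append_iff.1 h with ⟨a, h1, _⟩ | ⟨a, h1, _⟩
        · have := irr_prefix_unique b.2 c.2 (bridge_cat k) h h1
          simp [h1, this]
        · have := irr_prefix_unique c.2 b.2 (bridge_cat l) h.symm h1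
          simp [h1, this]
      rw [hbc, List.append_cancel_left_eq] at h
      rw [Subtype.ext hbc, ih h]

/-- A subword of a bridge that makes no progress to the right is contained in a single
irreducible factor. -/
lemma exists_long_irr {w a m b : Walk} (h : Bridge w) (hw : w = a ++ m ++ b) (hm : X m ≤ 0)
    (hm0 : m ≠ []) : ∃ p c s, w = p ++ c ++ s ∧ Bridge p ∧ Irr c ∧ Bridge s ∧
      m.length ≤ c.length := by
  induction hn : w.length using Nat.strong_induction_on generalizing w a b with
  | _ n ih =>
    by_cases hi : Irr w
    · exact ⟨[], w, [], by simp, bridge_nil, hi, bridge_nil, by simp [hw]; omega⟩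
    have hw0 : w ≠ [] := by rintro rfl; simp_all
    have : ∃ u v, w = u ++ v ∧ Bridge u ∧ Bridge v ∧ u ≠ [] ∧ v ≠ [] := by
      by_contra hc
      push Not at hc
      exact hi ⟨h, hw0, fun u v e hu hv => by
        by_contra h'
        push Not at h'
        exact h'.2 (hc u v e hu hv h'.1)⟩
    obtain ⟨u, v, rfl, hu, hv, hu0, hv0⟩ := this
    have h1 := List.length_pos_of_ne_nil hu0
    have h2 := List.length_pos_of_ne_nil hv0
    simp only [List.length_append] at hn
    have left : (∃ b', u = a ++ m ++ b') → ∃ p c s, u ++ v = p ++ c ++ s ∧ Bridge p ∧ Irr c ∧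
        Bridge s ∧ m.length ≤ c.length := by
      rintro ⟨b', hb'⟩
      obtain ⟨p, c, s, e, hp, hc, hs, hl⟩ := ih _ (by omega) hu hb' rfl
      exact ⟨p, c, s ++ v, by simp [e], hp, hc, hs.append hv, hl⟩
    rcases List.append_eq_append_iff.1 hw with ⟨x, h3, h4⟩ | ⟨x, h3, _⟩
    · rcases List.append_eq_append_iff.1 h3 with ⟨y, h5, h6⟩ | ⟨y, h5, h6⟩
      · rcases eq_or_ne x [] with rfl | hx
        · exact left ⟨[], by simp [h3]⟩
        · have := hu.nonneg y ⟨a, h5.symm⟩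
          have := hv.pos x ⟨b, h4.symm⟩ hx
          rw [h6, X_append] at hm
          omega
      · obtain ⟨p, c, s, e, hp, hc, hs, hl⟩ := ih _ (by omega) hv
          (show v = y ++ m ++ b by rw [h4, h6]) rfl
        exact ⟨u ++ p, c, s, by simp [e], hu.append hp, hc, hs, hl⟩
    · exact left ⟨x, h3⟩

/-! ### Backtracks -/

/-- The horizontal level `l` is straddled by a backtrack of `w` of size at least `d`. -/
def Backtrack (w : Walk) (l d : ℤ) : Prop :=
  ∃ b g c, w = b ++ g ++ c ∧ l ≤ X b ∧ X b + X g ≤ l ∧ d ≤ -X g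

lemma exists_prefix_X_eq (w : Walk) (l : ℤ) (h0 : 0 ≤ l) (hl : l ≤ X w) :
    ∃ b c, w = b ++ c ∧ X b = l := by
  induction w using List.reverseRecOn with
  | nil => exact ⟨[], [], rfl, by simp at *; omega⟩
  | append_singleton w a ih =>
    by_cases h : l ≤ X w
    · obtain ⟨b, c, rfl, hb⟩ := ih h
      exact ⟨b, c ++ [a], by simp, hb⟩
    · refine ⟨w ++ [a], [], by simp, ?_⟩
      cases a <;> simp [Step.dx] at * <;> omega

/-- Among the backtracks straddling a given level, one of maximal size splits the bridge into
three bridges, the middle one being reflected. -/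
lemma exists_unfold {w : Walk} (h : Bridge w) (l : ℤ) (h0 : 0 ≤ l) (hl : l ≤ X w) :
    ∃ b f c, w = b ++ f.map Step.flip ++ c ∧ Bridge b ∧ Bridge f ∧ Bridge c ∧
      l ≤ X b ∧ X b - X f ≤ l ∧ ∀ d, Backtrack w l d → d ≤ X f := by
  let P : ℕ × ℕ → Prop := fun ij => ∃ b g c, w = b ++ g ++ c ∧ l ≤ X b ∧ X b + X g ≤ l ∧
    b.length = ij.1 ∧ g.length = ij.2
  let T : Finset (ℕ × ℕ) :=
    (Finset.range (w.length + 1) ×ˢ Finset.range (w.length + 1)).filter P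
  have memT : ∀ b g c, w = b ++ g ++ c → l ≤ X b → X b + X g ≤ l → (b.length, g.length) ∈ T := by
    intro b g c hw h1 h2
    simp only [T, Finset.mem_filter, Finset.mem_product, Finset.mem_range]
    refine ⟨?_, b, g, c, hw, h1, h2, rfl, rfl⟩
    rw [hw]; simp; omega
  let key : ℕ × ℕ → ℤ ×ₗ (ℕ ×ₗ ℕ) := fun ij =>
    toLex (-X ((w.drop ij.1).take ij.2), toLex (ij.1 + ij.2, ij.1))
  have keyeq : ∀ b g c, w = b ++ g ++ c → key (b.length, g.length) =
      toLex (-X g, toLex (b.length + g.length, b.length)) := by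
    intro b g c hw
    simp [key, hw]
  have hT : T.Nonempty := by
    obtain ⟨b, c, hw, hb⟩ := exists_prefix_X_eq w l h0 hl
    exact ⟨_, memT b [] c (by simpa using hw) hb.ge (by simp [hb])⟩
  obtain ⟨ij, hij, hmax⟩ := Finset.exists_max_image T key hT
  obtain ⟨b, g, c, hw, h1, h2, h3, h4⟩ := (Finset.mem_filter.1 hij).2
  obtain rfl : ij = (b.length, g.length) := by rw [h3, h4]
  have best : ∀ b' g' c', w = b' ++ g' ++ c' → l ≤ X b' → X b' + X g' ≤ l →
      -X g' ≤ -X g ∧ (X g = X g' → b'.length + g'.length ≤ b.length + g.length ∧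
        (b.length + g.length = b'.length + g'.length → b'.length ≤ b.length)) := by
    intro b' g' c' hw' h1' h2'
    have := hmax _ (memT b' g' c' hw' h1' h2')
    rw [keyeq b' g' c' hw', keyeq b g c hw, Prod.Lex.toLex_le_toLex, Prod.Lex.toLex_le_toLex]
      at this
    simp only at this
    omega
  have hgX : X g ≤ 0 := by omega
  refine ⟨b, g.map Step.flip, c, by rw [map_flip_flip, hw], ?_, ?_, ?_, h1, by simpa using h2, ?_⟩
  · refine h.of_isPrefix ⟨g ++ c, by simp [hw]⟩ ?_
    rintro v ⟨t, rfl⟩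
    by_contra hv
    have := (best t (v ++ g) c (by simp [hw]) (by simp at h1; omega) (by simp at h2 ⊢; omega)).1
    simp at this
    omega
  · refine ⟨(h.sa.of_isInfix ⟨b, c, hw.symm⟩).flip, ?_, ?_⟩
    · intro u hu hn
      obtain ⟨v, ⟨t, rfl⟩, rfl⟩ := List.prefix_map_iff.1 hu
      have hv0 : v ≠ [] := by rintro rfl; simp at hn
      have hlen := List.length_pos_of_ne_nil hv0
      by_contra hv
      simp at hv h2 hgX
      obtain ⟨h5, h6⟩ := best (b ++ v) t c (by simp [hw]) (by simp; omega) (by simp; omega)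
      simp only [X_append, List.length_append] at h5 h6
      have h7 := h6 (by omega)
      omega
    · intro u hu
      obtain ⟨v, ⟨t, rfl⟩, rfl⟩ := List.suffix_map_iff.1 hu
      by_contra hv
      simp at hv h2 hgX
      have := best b t (v ++ c) (by simp [hw]) (by omega) (by omega)
      simp at this
      omega
  · refine h.of_suffix ⟨b ++ g, hw.symm⟩ ?_
    rintro v ⟨t, rfl⟩ hv0
    have hlen := List.length_pos_of_ne_nil hv0
    by_contra hv
    obtain ⟨h5, h6⟩ := best b (g ++ v) t (by simp [hw]) h1 (by simp; omega)
    simp only [X_append, List.length_append] at h5 h6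
    have h7 := h6 (by omega)
    omega
  · rintro d ⟨b', g', c', hw', h1', h2', h3'⟩
    have := (best b' g' c' hw' h1' h2').1
    simp
    omega

/-! ### Weighted sums over walks -/

lemma tsum_le_tsum_of_rel {α β : Type*} {f : α → ℝ≥0∞} {g : β → ℝ≥0∞} (R : α → β → Prop)
    (hR : ∀ a, ∃ b, R a b ∧ f a ≤ g b) (inj : ∀ a a' b, R a b → R a' b → a = a') :
    ∑' a, f a ≤ ∑' b, g b := by
  choose i hi hfg using hR
  have hinj : Function.Injective i := fun a a' h => inj a a' (i a) (hi a) (h ▸ hi a')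
  exact (ENNReal.tsum_le_tsum hfg).trans (ENNReal.tsum_comp_le_tsum_of_injective hinj g)

/-- The sum of `f` over the walks satisfying `P`. -/
noncomputable def wsum (P : Walk → Prop) (f : Walk → ℝ≥0∞) : ℝ≥0∞ :=
  ∑' w : {w : Walk // P w}, f w.1

lemma wsum_mono {P Q : Walk → Prop} {f g : Walk → ℝ≥0∞} (h : ∀ w, P w → Q w ∧ f w ≤ g w) :
    wsum P f ≤ wsum Q g :=
  tsum_le_tsum_of_rel (fun a b => a.1 = b.1)
    (fun a => ⟨⟨a.1, (h _ a.2).1⟩, rfl, (h _ a.2).2⟩)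
    (fun _ _ _ h h' => Subtype.ext (h.trans h'.symm))

lemma wsum_le_add {P Q R : Walk → Prop} (f : Walk → ℝ≥0∞) (h : ∀ w, P w → Q w ∨ R w) :
    wsum P f ≤ wsum Q f + wsum R f := by
  have : wsum P f ≤ wsum (fun w => Q w ∨ R w) f := wsum_mono fun w hw => ⟨h w hw, le_rfl⟩
  exact this.trans (ENNReal.tsum_union_le f {w | Q w} {w | R w})

lemma wsum_mul_left (P : Walk → Prop) (a : ℝ≥0∞) (f : Walk → ℝ≥0∞) :
    wsum P (fun w => a * f w) = a * wsum P f := ENNReal.tsum_mul_left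

lemma wsum_eq_tsum_ite (P : Walk → Prop) (f : Walk → ℝ≥0∞) :
    wsum P f = ∑' w, if P w then f w else 0 := by
  have := tsum_subtype {w | P w} f
  simp only [Set.indicator, Set.mem_ofPred_eq] at this
  exact this

/-- The weight `exp (lam * X w - s * |w|)` of a walk. -/
noncomputable def ew (lam s : ℝ) (w : Walk) : ℝ≥0∞ :=
  ENNReal.ofReal (Real.exp (lam * X w - s * w.length))

@[simp] lemma ew_nil (lam s : ℝ) : ew lam s [] = 1 := by simp [ew]

@[simp] lemma ew_append (lam s : ℝ) (u v : Walk) :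
    ew lam s (u ++ v) = ew lam s u * ew lam s v := by
  rw [ew, ew, ew, ← ENNReal.ofReal_mul (Real.exp_pos _).le, ← Real.exp_add]
  congr 2
  simp
  ring

lemma ew_ne_top (lam s : ℝ) (w : Walk) : ew lam s w ≠ ⊤ := ENNReal.ofReal_ne_top

lemma ew_ne_zero (lam s : ℝ) (w : Walk) : ew lam s w ≠ 0 := by
  simp [ew, Real.exp_pos]

@[simp] lemma ew_zero_map (s : ℝ) (f : Step → Step) (w : Walk) : ew 0 s (w.map f) = ew 0 s w := by
  simp [ew]

lemma ew_le_ew {lam s lam' s' : ℝ} {w w' : Walk}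
    (h : lam * X w - s * w.length ≤ lam' * X w' - s' * w'.length) :
    ew lam s w ≤ ew lam' s' w' :=
  ENNReal.ofReal_le_ofReal (Real.exp_le_exp.2 h)

lemma ew_cat (lam s : ℝ) (l : List I) :
    ew lam s (cat l) = (l.map fun b => ew lam s b.1).prod := by
  induction l with
  | nil => simp
  | cons b l ih => simp [ih]

/-! ### Renewal structure of bridges -/

lemma tsum_length_eq {α : Type*} (f : α → ℝ≥0∞) (k : ℕ) :
    ∑' l : {l : List α // l.length = k}, (l.1.map f).prod = (∑' a, f a) ^ k := by
  induction k with
  | zero =>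
    have : Unique {l : List α // l.length = 0} :=
      ⟨⟨⟨[], rfl⟩⟩, fun a => Subtype.ext (List.length_eq_zero_iff.1 a.2)⟩
    rw [tsum_eq_single (default : {l : List α // l.length = 0})
      (fun b hb => absurd (Subsingleton.elim _ _) hb)]
    rw [Subsingleton.elim (default : {l : List α // l.length = 0}) ⟨[], rfl⟩]
    simp
  | succ k ih =>
    let e : α × {l : List α // l.length = k} ≃ {l : List α // l.length = k + 1} :=
      { toFun := fun p => ⟨p.1 :: p.2.1, by simp [p.2.2]⟩
        invFun := fun l => ⟨l.1.head (List.ne_nil_of_length_eq_add_one l.2),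
          l.1.tail, by simp [l.2]⟩
        left_inv := fun p => by simp
        right_inv := fun l => by simp }
    rw [← e.tsum_eq, ENNReal.tsum_prod']
    simp only [e, Equiv.coe_fn_mk, List.map_cons, List.prod_cons]
    simp_rw [ENNReal.tsum_mul_left, ih, ENNReal.tsum_mul_right]
    rw [pow_succ']

lemma tsum_list {α : Type*} (f : α → ℝ≥0∞) (g : ℕ → ℝ≥0∞) :
    ∑' l : List α, g l.length * (l.map f).prod = ∑' k, g k * (∑' a, f a) ^ k := by
  rw [← ENNReal.tsum_fiberwise _ (List.length : List α → ℕ)]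
  refine tsum_congr fun k => ?_
  rw [← tsum_length_eq, ← ENNReal.tsum_mul_left]
  refine tsum_congr fun l => ?_
  rw [show l.1.length = k from l.2]

lemma wsum_bridge_and (P : Walk → Prop) (f : Walk → ℝ≥0∞) :
    wsum (fun w => Bridge w ∧ P w) f = ∑' l : List I, if P (cat l) then f (cat l) else 0 := by
  rw [wsum_eq_tsum_ite, ← cat_injective.tsum_eq]
  · refine tsum_congr fun l => ?_
    by_cases hP : P (cat l)
    · exact (if_pos ⟨bridge_cat l, hP⟩).trans (if_pos hP).symm
    · exact (if_neg fun h => hP h.2).trans (if_neg hP).symm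
  · intro w hw
    by_contra hc
    exact hw (if_neg fun h => hc (exists_cat h.1))

/-- The generating function of irreducible bridges. -/
noncomputable def q (lam s : ℝ) : ℝ≥0∞ := ∑' b : I, ew lam s b.1

lemma wsum_bridge_eq (lam s : ℝ) : wsum Bridge (ew lam s) = (1 - q lam s)⁻¹ := by
  have h := wsum_bridge_and (fun _ => True) (ew lam s)
  have h2 := tsum_list (fun b : I => ew lam s b.1) (fun _ => 1)
  simp only [and_true, if_true, ew_cat] at h
  simp only [one_mul] at h2
  rw [← ENNReal.tsum_geometric]
  exact h.trans h2

lemma wsum_bridge_X_le (s : ℝ) (hq : q 0 s ≤ 1) (n : ℕ) :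
    wsum (fun w => Bridge w ∧ X w ≤ n) (ew 0 s) ≤ n + 1 := by
  rw [wsum_bridge_and]
  calc _ ≤ ∑' l : List I, (if l.length ≤ n then 1 else 0) *
          (l.map fun b => ew 0 s b.1).prod := by
        refine ENNReal.tsum_le_tsum fun l => ?_
        split_ifs with h1 h2
        · simp [ew_cat]
        · have := length_le_X_cat l
          omega
        · simp
        · simp
    _ = ∑' k, (if k ≤ n then 1 else 0) * q 0 s ^ k :=
        tsum_list (fun b : I => ew 0 s b.1) fun k => if k ≤ n then 1 else 0
    _ = ∑ k ∈ Finset.range (n + 1), (if k ≤ n then 1 else 0) * q 0 s ^ k := by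
        refine tsum_eq_sum fun k hk => ?_
        rw [Finset.mem_range] at hk
        simp only [ite_mul, one_mul, zero_mul, ite_eq_right_iff]
        omega
    _ ≤ ∑ k ∈ Finset.range (n + 1), 1 := by
        refine Finset.sum_le_sum fun k _ => ?_
        split_ifs
        · simpa using pow_le_one' hq k
        · simp
    _ = n + 1 := by simp

/-! ### The connective constant -/

lemma finite_saw (n : ℕ) : {w : Walk | SelfAvoiding w ∧ w.length = n}.Finite :=
  (List.finite_length_eq Step n).subset fun _ h => h.2

/-- The number of self-avoiding walks of length `n`. -/
noncomputable def cnt (n : ℕ) : ℕ := {w : Walk | SelfAvoiding w ∧ w.length = n}.ncard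

lemma selfAvoiding_replicate (n : ℕ) : SelfAvoiding (List.replicate n Step.east) := by
  rintro u hu hn ⟨h, -⟩
  obtain ⟨k, rfl⟩ : ∃ k, u = List.replicate k Step.east :=
    ⟨_, List.eq_replicate_of_mem fun b hb => List.eq_of_mem_replicate (hu.subset hb)⟩
  have : X (List.replicate k Step.east) = k := by simp [X, Step.dx]
  rw [this] at h
  exact hn (by simp [Nat.cast_eq_zero.1 h])

lemma cnt_pos (n : ℕ) : 0 < cnt n :=
  (Set.ncard_pos (finite_saw n)).2
    ⟨List.replicate n Step.east, selfAvoiding_replicate n, by simp⟩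

lemma cnt_add_le (m n : ℕ) : cnt (m + n) ≤ cnt m * cnt n := by
  rw [cnt, cnt, cnt, ← Set.ncard_prod]
  refine Set.ncard_le_ncard_of_injOn (fun w => (w.take m, w.drop m)) ?_ ?_
    ((finite_saw m).prod (finite_saw n))
  · rintro w ⟨h, hl⟩
    exact ⟨⟨h.of_isInfix (List.take_prefix m w).isInfix, by simp [hl]⟩,
      h.of_isInfix (List.drop_suffix m w).isInfix, by simp [hl]⟩
  · intro a _ b _ hab
    rw [Prod.mk.injEq] at hab
    rw [← List.take_append_drop m a, ← List.take_append_drop m b, hab.1, hab.2]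

lemma subadditive_log_cnt : Subadditive fun n => Real.log (cnt n) := fun m n => by
  have h1 : (0 : ℝ) < cnt m := by exact_mod_cast cnt_pos m
  have h2 : (0 : ℝ) < cnt n := by exact_mod_cast cnt_pos n
  have h3 : (0 : ℝ) < cnt (m + n) := by exact_mod_cast cnt_pos (m + n)
  rw [← Real.log_mul h1.ne' h2.ne']
  exact Real.log_le_log h3 (by exact_mod_cast cnt_add_le m n)

lemma bddBelow_log_cnt : BddBelow (Set.range fun n : ℕ => Real.log (cnt n) / n) := by
  refine ⟨0, ?_⟩
  rintro _ ⟨n, rfl⟩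
  have : (1 : ℝ) ≤ cnt n := by exact_mod_cast cnt_pos n
  exact div_nonneg (Real.log_nonneg this) (Nat.cast_nonneg n)

/-- The logarithm of the connective constant. -/
noncomputable def sig : ℝ := subadditive_log_cnt.lim

lemma exp_sig_le_cnt (n : ℕ) : Real.exp (sig * n) ≤ cnt n := by
  have h1 : (0 : ℝ) < cnt n := by exact_mod_cast cnt_pos n
  rcases eq_or_ne n 0 with rfl | hn
  · simpa using Nat.one_le_iff_ne_zero.2 (cnt_pos 0).ne'
  · rw [← Real.le_log_iff_exp_le h1]
    have h := subadditive_log_cnt.lim_le_div bddBelow_log_cnt hn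
    rwa [le_div_iff₀ (by positivity)] at h

lemma exists_cnt_le {s : ℝ} (hs : sig < s) :
    ∃ C : ℝ, 0 ≤ C ∧ ∀ n, cnt n ≤ C * Real.exp (s * n) := by
  have h := (subadditive_log_cnt.tendsto_lim bddBelow_log_cnt).eventually_lt_const hs
  have hb : ∀ᶠ n : ℕ in atTop, (cnt n : ℝ) / Real.exp (s * n) ≤ 1 := by
    filter_upwards [h, eventually_gt_atTop 0] with n hn h0
    have h1 : (0 : ℝ) < cnt n := by exact_mod_cast cnt_pos n
    rw [div_le_one (Real.exp_pos _), ← Real.log_le_iff_le_exp h1]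
    rw [div_lt_iff₀ (by positivity)] at hn
    exact hn.le
  obtain ⟨C, hC⟩ := (Filter.isBoundedUnder_of_eventually_le hb).bddAbove_range
  refine ⟨max C 0, le_max_right _ _, fun n => ?_⟩
  have := (hC ⟨n, rfl⟩).trans (le_max_left C 0)
  rwa [div_le_iff₀ (Real.exp_pos _)] at this

lemma wsum_length_eq (n : ℕ) (s : ℝ) :
    wsum (fun w => SelfAvoiding w ∧ w.length = n) (ew 0 s) =
      cnt n * ENNReal.ofReal (Real.exp (-s * n)) := by
  have : Fintype {w : Walk // SelfAvoiding w ∧ w.length = n} := (finite_saw n).fintype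
  have h : ∀ w : {w : Walk // SelfAvoiding w ∧ w.length = n},
      ew 0 s w.1 = ENNReal.ofReal (Real.exp (-s * n)) := by
    rintro ⟨w, h1, h2⟩
    simp [ew, h2]
  rw [wsum, tsum_congr h, tsum_fintype, Finset.sum_const, nsmul_eq_mul, cnt,
    ← Nat.card_coe_set_eq, Finset.card_univ, ← Nat.card_eq_fintype_card]
  rfl

lemma wsum_selfAvoiding_ne_top {s : ℝ} (hs : sig < s) : wsum SelfAvoiding (ew 0 s) ≠ ⊤ := by
  obtain ⟨t, ht, hts⟩ := exists_between hs
  obtain ⟨C, hC0, hC⟩ := exists_cnt_le ht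
  have h1 : wsum SelfAvoiding (ew 0 s) ≤
      ∑' n, wsum (fun w => SelfAvoiding w ∧ w.length = n) (ew 0 s) := by
    have h2 := ENNReal.tsum_sigma (fun (n : ℕ) (w : {w : Walk // SelfAvoiding w ∧ w.length = n}) =>
      ew 0 s w.1)
    refine le_trans ?_ h2.le
    exact tsum_le_tsum_of_rel (fun a b => a.1 = b.2.1)
      (fun a => ⟨⟨a.1.length, a.1, a.2, rfl⟩, rfl, le_rfl⟩)
      (fun _ _ _ h h' => Subtype.ext (h.trans h'.symm))
  have h3 : ∀ n : ℕ, wsum (fun w => SelfAvoiding w ∧ w.length = n) (ew 0 s) ≤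
      ENNReal.ofReal C * ENNReal.ofReal (Real.exp (t - s)) ^ n := by
    intro n
    rw [wsum_length_eq, ← ENNReal.ofReal_pow (Real.exp_pos _).le, ← ENNReal.ofReal_mul hC0,
      ← ENNReal.ofReal_natCast, ← ENNReal.ofReal_mul (Nat.cast_nonneg _), ← Real.exp_nat_mul]
    refine ENNReal.ofReal_le_ofReal ?_
    refine (mul_le_mul_of_nonneg_right (hC n) (Real.exp_pos _).le).trans_eq ?_
    rw [mul_assoc, ← Real.exp_add]
    ring_nf
  refine ne_top_of_le_ne_top ?_ (h1.trans (ENNReal.tsum_le_tsum h3))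
  rw [ENNReal.tsum_mul_left, ENNReal.tsum_geometric]
  refine ENNReal.mul_ne_top ENNReal.ofReal_ne_top (ENNReal.inv_ne_top.2 ?_)
  rw [ne_eq, tsub_eq_zero_iff_le, not_le, ENNReal.ofReal_lt_one]
  exact Real.exp_lt_one_iff.2 (by linarith)

lemma wsum_bridge_ne_top {s : ℝ} (hs : sig < s) : wsum Bridge (ew 0 s) ≠ ⊤ :=
  ne_top_of_le_ne_top (wsum_selfAvoiding_ne_top hs) (wsum_mono fun _ h => ⟨h.sa, le_rfl⟩)

lemma q_lt_one_of_ne_top {lam s : ℝ} (h : wsum Bridge (ew lam s) ≠ ⊤) : q lam s < 1 := by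
  rw [wsum_bridge_eq, ENNReal.inv_ne_top, ne_eq, tsub_eq_zero_iff_le, not_le] at h
  exact h

lemma q_lt_one {s : ℝ} (hs : sig < s) : q 0 s < 1 := q_lt_one_of_ne_top (wsum_bridge_ne_top hs)

lemma wsum_le_mul {P P₁ P₂ : Walk → Prop} {f f₁ f₂ : Walk → ℝ≥0∞} (F : Walk → Walk → Walk)
    (h : ∀ w, P w → ∃ a b, w = F a b ∧ P₁ a ∧ P₂ b ∧ f w ≤ f₁ a * f₂ b) :
    wsum P f ≤ wsum P₁ f₁ * wsum P₂ f₂ := by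
  have e : wsum P₁ f₁ * wsum P₂ f₂ =
      ∑' p : {w : Walk // P₁ w} × {w : Walk // P₂ w}, f₁ p.1.1 * f₂ p.2.1 := by
    rw [ENNReal.tsum_prod']
    simp_rw [ENNReal.tsum_mul_left, ENNReal.tsum_mul_right]
    rfl
  rw [e]
  refine tsum_le_tsum_of_rel (fun w p => w.1 = F p.1.1 p.2.1) (fun w => ?_)
    fun _ _ _ h h' => Subtype.ext (h.trans h'.symm)
  obtain ⟨a, b, h1, h2, h3, h4⟩ := h w.1 w.2
  exact ⟨(⟨a, h2⟩, ⟨b, h3⟩), h1, h4⟩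

lemma wsum_le_mul₃ {P P₁ P₂ P₃ : Walk → Prop} {f f₁ f₂ f₃ : Walk → ℝ≥0∞}
    (F : Walk → Walk → Walk → Walk)
    (h : ∀ w, P w → ∃ a b c, w = F a b c ∧ P₁ a ∧ P₂ b ∧ P₃ c ∧ f w ≤ f₁ a * f₂ b * f₃ c) :
    wsum P f ≤ wsum P₁ f₁ * wsum P₂ f₂ * wsum P₃ f₃ := by
  have e : wsum P₁ f₁ * wsum P₂ f₂ * wsum P₃ f₃ =
      ∑' p : {w : Walk // P₁ w} × {w : Walk // P₂ w} × {w : Walk // P₃ w},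
        f₁ p.1.1 * f₂ p.2.1.1 * f₃ p.2.2.1 := by
    rw [ENNReal.tsum_prod']
    simp_rw [ENNReal.tsum_prod', ENNReal.tsum_mul_left, ENNReal.tsum_mul_right,
      ENNReal.tsum_mul_left, ENNReal.tsum_mul_right]
    rfl
  rw [e]
  refine tsum_le_tsum_of_rel (fun w p => w.1 = F p.1.1 p.2.1.1 p.2.2.1) (fun w => ?_)
    fun _ _ _ h h' => Subtype.ext (h.trans h'.symm)
  obtain ⟨a, b, c, h1, h2, h3, h4, h5⟩ := h w.1 w.2
  exact ⟨(⟨a, h2⟩, ⟨b, h3⟩, ⟨c, h4⟩), h1, h5⟩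

lemma wsum_le_of_forall_le {P : Walk → Prop} {f : Walk → ℝ≥0∞} {K : ℝ≥0∞} (m : Walk → ℕ)
    (h : ∀ n, wsum (fun w => P w ∧ m w ≤ n) f ≤ K) : wsum P f ≤ K := by
  rw [wsum, ENNReal.tsum_eq_iSup_sum]
  refine iSup_le fun t => ?_
  obtain ⟨n, hn⟩ : ∃ n, ∀ w ∈ t, m w.1 ≤ n :=
    ⟨t.sup fun w => m w.1, fun w hw => Finset.le_sup (f := fun w => m w.1) hw⟩
  refine le_trans ?_ (h n)
  rw [← Finset.tsum_subtype, wsum]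
  exact tsum_le_tsum_of_rel (fun a b => a.1.1 = b.1)
    (fun a => ⟨⟨a.1.1, a.1.2, hn _ a.2⟩, rfl, le_rfl⟩)
    (fun _ _ _ h h' => Subtype.ext (Subtype.ext (h.trans h'.symm)))

/-! ### Rates -/

/-- Bridges of speed at least `v` have strictly smaller exponential growth than walks. -/
def Bad (v : ℝ) : Prop :=
  ∃ η > 0, wsum (fun w => Bridge w ∧ v * w.length ≤ X w) (ew 0 (sig - η)) ≠ ⊤

lemma bad_two : Bad 2 := by
  refine ⟨1, one_pos, ne_top_of_le_ne_top (wsum_bridge_ne_top (lt_add_one sig))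
    (wsum_mono fun w hw => ⟨hw.1, ?_⟩)⟩
  have h1 : (X w : ℝ) ≤ w.length := by exact_mod_cast X_le_length w
  have h2 : (w.length : ℝ) = 0 := by
    have : (0 : ℝ) ≤ w.length := Nat.cast_nonneg _
    linarith [hw.2]
  have h3 : w = [] := List.length_eq_zero_iff.1 (by exact_mod_cast h2)
  simp [h3]

lemma Bad.mono {u v : ℝ} (h : Bad u) (huv : u ≤ v) : Bad v := by
  obtain ⟨η, h0, h1⟩ := h
  refine ⟨η, h0, ne_top_of_le_ne_top h1 (wsum_mono fun w hw => ⟨⟨hw.1, ?_⟩, le_rfl⟩)⟩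
  exact (mul_le_mul_of_nonneg_right huv (Nat.cast_nonneg _)).trans hw.2

lemma Bad.wsum_ne_top {u δ : ℝ} (h : Bad u) (hu : 0 ≤ u) (hδ : 0 < δ) :
    ∃ lam > 0, wsum Bridge (ew lam (sig + lam * (u + δ))) ≠ ⊤ := by
  obtain ⟨η, h0, h1⟩ := h
  refine ⟨η, h0, ?_⟩
  refine ne_top_of_le_ne_top ?_ (wsum_le_add (Q := fun w => Bridge w ∧ u * w.length ≤ X w)
    (R := fun w => Bridge w ∧ X w < u * w.length) _ fun w hw => ?_)
  · refine ENNReal.add_ne_top.2 ⟨ne_top_of_le_ne_top h1 (wsum_mono fun w hw => ⟨hw, ?_⟩),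
      ne_top_of_le_ne_top (wsum_bridge_ne_top (show sig < sig + η * δ by
        have := mul_pos h0 hδ; linarith)) (wsum_mono fun w hw => ⟨hw.1, ?_⟩)⟩
    · apply ew_le_ew
      have h2 : (X w : ℝ) ≤ w.length := by exact_mod_cast X_le_length w
      have h3 : (0 : ℝ) ≤ η * (u + δ) * w.length := by positivity
      nlinarith
    · apply ew_le_ew
      nlinarith [hw.2]
  · rcases le_or_gt (u * w.length) (X w) with h | h
    · exact Or.inl ⟨hw, h⟩
    · exact Or.inr ⟨hw, h⟩

/-! ### The Hammersley–Welsh decomposition -/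

/-- The largest abscissa visited by a walk. -/
def mx : Walk → ℕ
  | [] => 0
  | a :: w => (a.dx + mx w).toNat

lemma X_le_mx {u w : Walk} (h : u <+: w) : X u ≤ mx w := by
  induction w generalizing u with
  | nil => simp [List.prefix_nil.1 h, mx]
  | cons a w ih =>
    rcases List.prefix_cons_iff.1 h with rfl | ⟨t, rfl, ht⟩
    · simp
    · have := ih ht
      simp only [X_cons, mx]
      omega

lemma exists_X_eq_mx (w : Walk) : ∃ u, u <+: w ∧ X u = mx w := by
  induction w with
  | nil => exact ⟨[], by simp, by simp [mx]⟩
  | cons a w ih =>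
    obtain ⟨u, hu, h⟩ := ih
    rcases le_total 0 (a.dx + (mx w : ℤ)) with h0 | h0
    · exact ⟨a :: u, by simpa using hu, by simp only [X_cons, mx]; omega⟩
    · exact ⟨[], by simp, by simp only [X_nil, mx]; omega⟩

/-- A self-avoiding walk that stays strictly to the right of its starting point. -/
structure HalfSpace (w : Walk) : Prop where
  sa : SelfAvoiding w
  pos : ∀ u, u <+: w → u ≠ [] → 0 < X u

/-- The weight of a half-space walk. -/
noncomputable def hw (lam s : ℝ) (w : Walk) : ℝ≥0∞ :=
  ENNReal.ofReal (Real.exp (lam * mx w - s * w.length))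

lemma exists_last_X_eq (w : Walk) (m : ℤ) (h : ∃ u, u <+: w ∧ X u = m) :
    ∃ u v, w = u ++ v ∧ X u = m ∧ ∀ t, t <+: v → t ≠ [] → X t ≠ 0 := by
  induction hn : w.length using Nat.strong_induction_on generalizing w m with
  | _ n ih =>
    obtain ⟨u, ⟨v, rfl⟩, hu⟩ := h
    by_cases hc : ∀ t, t <+: v → t ≠ [] → X t ≠ 0
    · exact ⟨u, v, rfl, hu, hc⟩
    · push Not at hc
      obtain ⟨t, ⟨r, rfl⟩, ht, ht0⟩ := hc
      have := List.length_pos_of_ne_nil ht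
      obtain ⟨a, b, e, ha, hb⟩ := ih r.length (by simp at hn; omega) r 0 ⟨[], by simp, rfl⟩ rfl
      exact ⟨u ++ (t ++ a), b, by simp [e], by simp; omega, hb⟩

lemma HalfSpace.split {w : Walk} (h : HalfSpace w) :
    ∃ b r, w = b ++ r.map Step.flip ∧ Bridge b ∧ X b = mx w ∧ HalfSpace r ∧
      (w ≠ [] → mx r < mx w) := by
  obtain ⟨b, r, rfl, hb, hr⟩ := exists_last_X_eq w _ (exists_X_eq_mx w)
  have hle : ∀ t, t <+: r → X t ≤ 0 := fun t ht => by
    have := X_le_mx (u := b ++ t) (w := b ++ r) (by simpa using ht)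
    rw [X_append] at this
    omega
  refine ⟨b, r.map Step.flip, by rw [map_flip_flip],
    ⟨h.sa.of_isInfix (List.prefix_append b r).isInfix, ?_, ?_⟩, hb,
    ⟨(h.sa.of_isInfix (List.suffix_append b r).isInfix).flip, ?_⟩, ?_⟩
  · exact fun u hu hn => h.pos u (hu.trans (List.prefix_append b r)) hn
  · rintro v ⟨u, rfl⟩
    have := X_le_mx (u := u) (w := u ++ v ++ r) (by simp)
    rw [X_append] at hb
    omega
  · intro u hu hn
    obtain ⟨t, ht, rfl⟩ := List.prefix_map_iff.1 hu
    have h1 := hle t ht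
    have h2 := hr t ht (by simpa using hn)
    rw [X_flip]
    omega
  · intro hw
    obtain ⟨u, hu, h1⟩ := exists_X_eq_mx (r.map Step.flip)
    obtain ⟨t, ht, rfl⟩ := List.prefix_map_iff.1 hu
    rw [← Int.ofNat_lt, ← h1, ← hb, X_flip]
    by_cases hbt : b ++ t = []
    · have hb0 : b = [] := (List.append_eq_nil_iff.1 hbt).1
      have := h.pos (b ++ r) (List.prefix_refl _) hw
      have := hle r (List.prefix_refl _)
      subst hb0
      simp at *
      omega
    · have := h.pos (b ++ t) (by simpa using ht) hbt
      rw [X_append] at this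
      omega

lemma wsum_halfSpace_le {lam s : ℝ} (hl : 0 ≤ lam) (n : ℕ) :
    wsum (fun w => HalfSpace w ∧ mx w ≤ n + 1) (hw lam s) ≤
      (1 + wsum (fun w => Bridge w ∧ X w = n + 1) (ew lam s)) *
        wsum (fun w => HalfSpace w ∧ mx w ≤ n) (hw lam s) := by
  rw [add_mul, one_mul]
  refine (wsum_le_add (Q := fun w => HalfSpace w ∧ mx w ≤ n)
    (R := fun w => HalfSpace w ∧ mx w = n + 1) _ fun w hw => ?_).trans (add_le_add le_rfl ?_)
  · rcases Nat.lt_or_ge n (mx w) with h | h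
    · exact Or.inr ⟨hw.1, by omega⟩
    · exact Or.inl ⟨hw.1, h⟩
  · refine wsum_le_mul (fun b r => b ++ r.map Step.flip) fun w ⟨h, hm⟩ => ?_
    obtain ⟨b, r, h1, h2, h3, h4, h5⟩ := h.split
    have h6 : w ≠ [] := by
      rintro rfl
      simp [mx] at hm
    have h7 := h5 h6
    refine ⟨b, r, h1, ⟨h2, by omega⟩, ⟨h4, by omega⟩, ?_⟩
    rw [hw, hw, ew, ← ENNReal.ofReal_mul (Real.exp_pos _).le, ← Real.exp_add]
    refine ENNReal.ofReal_le_ofReal (Real.exp_le_exp.2 ?_)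
    rw [h3, h1]
    push_cast [List.length_append, List.length_map]
    have : 0 ≤ lam * mx r := by positivity
    nlinarith

lemma wsum_halfSpace_ne_top {lam s : ℝ} (hl : 0 ≤ lam) (h : wsum Bridge (ew lam s) ≠ ⊤) :
    wsum HalfSpace (hw lam s) ≠ ⊤ := by
  set B : ℕ → ℝ≥0∞ := fun n => wsum (fun w => Bridge w ∧ X w = n) (ew lam s) with hB
  have hsum : ∑' n, B n ≤ wsum Bridge (ew lam s) := by
    have h2 := ENNReal.tsum_sigma (fun (n : ℕ) (w : {w : Walk // Bridge w ∧ X w = n}) =>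
      ew lam s w.1)
    refine h2.ge.trans ?_
    exact tsum_le_tsum_of_rel (fun a b => a.2.1 = b.1)
      (fun a => ⟨⟨a.2.1, a.2.2.1⟩, rfl, le_rfl⟩) (by
        rintro ⟨n, a, ha⟩ ⟨m, a', ha'⟩ b h h'
        obtain rfl : a = a' := h.trans h'.symm
        obtain rfl : n = m := by
          have := ha.2.symm.trans ha'.2
          exact_mod_cast this
        rfl)
  have hB0 : ∑' n, B n ≠ ⊤ := ne_top_of_le_ne_top h hsum
  have hle : ∀ n, 1 + B n ≤ ENNReal.ofReal (Real.exp (B n).toReal) := fun n => by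
    have hn : B n ≠ ⊤ := ENNReal.ne_top_of_tsum_ne_top hB0 n
    rw [← ENNReal.ofReal_toReal hn, ← ENNReal.ofReal_one, ← ENNReal.ofReal_add zero_le_one
      ENNReal.toReal_nonneg, ENNReal.toReal_ofReal ENNReal.toReal_nonneg]
    refine ENNReal.ofReal_le_ofReal ?_
    linarith [Real.add_one_le_exp (B n).toReal]
  have key : ∀ n, wsum (fun w => HalfSpace w ∧ mx w ≤ n) (hw lam s) ≤
      ENNReal.ofReal (Real.exp (∑ k ∈ Finset.range n, (B (k + 1)).toReal)) := by
    intro n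
    induction n with
    | zero =>
      have h1 : ∀ w, HalfSpace w ∧ mx w ≤ 0 → w = [] := by
        rintro w ⟨h, hm⟩
        by_contra hne
        have := h.pos w (List.prefix_refl _) hne
        have := X_le_mx (List.prefix_refl w)
        omega
      simp only [Finset.range_zero, Finset.sum_empty, Real.exp_zero, ENNReal.ofReal_one]
      have h2 : wsum (fun w => HalfSpace w ∧ mx w ≤ 0) (hw lam s) ≤ ∑' _ : Unit, (1 : ℝ≥0∞) :=
        tsum_le_tsum_of_rel (fun _ _ => True)
          (fun a => ⟨(), trivial, by simp [h1 a.1 a.2, hw, mx]⟩)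
          (fun a b _ _ _ => Subtype.ext ((h1 a.1 a.2).trans (h1 b.1 b.2).symm))
      simpa using h2
    | succ n ih =>
      refine (wsum_halfSpace_le hl n).trans ?_
      rw [Finset.sum_range_succ, Real.exp_add, ENNReal.ofReal_mul (Real.exp_pos _).le]
      refine (mul_le_mul' ?_ ih).trans_eq (mul_comm _ _)
      have := hle (n + 1)
      simpa [hB] using this
  refine ne_top_of_le_ne_top (ENNReal.ofReal_ne_top (r := Real.exp (∑' n, B n).toReal))
    (wsum_le_of_forall_le mx fun n => (key n).trans ?_)
  refine ENNReal.ofReal_le_ofReal (Real.exp_le_exp.2 ?_)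
  rw [← ENNReal.toReal_sum fun k _ => ENNReal.ne_top_of_tsum_ne_top hB0 (k + 1)]
  refine ENNReal.toReal_mono hB0 ?_
  exact (ENNReal.sum_le_tsum _).trans
    (ENNReal.tsum_comp_le_tsum_of_injective (add_left_injective 1) B)

lemma SelfAvoiding.split {w : Walk} (h : SelfAvoiding w) :
    ∃ u r, w = u ++ r ∧ HalfSpace r ∧ HalfSpace (Step.east :: u.reverse.map Step.neg) ∧
      X w ≤ mx r := by
  obtain ⟨t, ht, hX⟩ := exists_X_eq_mx (w.map Step.flip)
  obtain ⟨t, htw, rfl⟩ := List.prefix_map_iff.1 ht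
  rw [X_flip] at hX
  have hmin : ∀ v, v <+: w → X t ≤ X v := fun v hv => by
    have := X_le_mx (List.IsPrefix.map Step.flip hv)
    rw [X_flip] at this
    omega
  obtain ⟨u, r, rfl, hu, hr⟩ := exists_last_X_eq w _ ⟨t, htw, rfl⟩
  have hsuf : ∀ v, v <:+ u → X v ≤ 0 := by
    rintro v ⟨p, rfl⟩
    have := hmin p (by simp)
    rw [X_append] at hu
    omega
  have hneg : ∀ v, v <+: u.reverse.map Step.neg → 0 ≤ X v := by
    intro v hv
    obtain ⟨t, ht, rfl⟩ := List.prefix_map_iff.1 hv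
    have := hsuf t.reverse (by rw [← List.reverse_prefix]; simpa using ht)
    simp only [X_reverse, X_neg] at *
    omega
  refine ⟨u, r, rfl, ⟨h.of_isInfix (List.suffix_append u r).isInfix, fun v hv hn => ?_⟩,
    ⟨?_, ?_⟩, ?_⟩
  · have h1 := hmin (u ++ v) (by simpa using hv)
    have h2 := hr v hv hn
    rw [X_append] at h1
    omega
  · have hu' : SelfAvoiding (u.reverse.map Step.neg) :=
      (h.of_isInfix (List.prefix_append u r).isInfix).reverse.neg
    refine SelfAvoiding.append (a := [Step.east]) (selfAvoiding_replicate 1) hu' ?_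
    rintro p v hp hv hp0 - ⟨h0, -⟩
    have hp1 : p = [Step.east] := by
      rcases List.suffix_cons_iff.1 hp with h1 | h1
      · exact h1
      · exact absurd (List.suffix_nil.1 h1) hp0
    have := hneg v hv
    rw [hp1] at h0
    simp [Step.dx] at h0
    omega
  · intro v hv hn
    rcases List.prefix_cons_iff.1 hv with rfl | ⟨t, rfl, ht⟩
    · exact absurd rfl hn
    · have := hneg t ht
      simp only [X_cons, Step.dx]
      omega
  · have := X_le_mx (List.prefix_refl r)
    have := hsuf u (List.suffix_refl u)
    simp
    omega

lemma map_neg_neg (w : Walk) : (w.map Step.neg).map Step.neg = w := by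
  induction w with
  | nil => rfl
  | cons a w ih => cases a <;> simpa [Step.neg] using ih

lemma wsum_selfAvoiding_tilt_ne_top {lam s : ℝ} (hl : 0 ≤ lam) (h : wsum Bridge (ew lam s) ≠ ⊤) :
    wsum SelfAvoiding (ew lam s) ≠ ⊤ := by
  have hK := wsum_halfSpace_ne_top hl h
  have key : wsum SelfAvoiding (ew lam s) ≤
      wsum HalfSpace (fun w => ENNReal.ofReal (Real.exp s) * hw lam s w) *
        wsum HalfSpace (hw lam s) := by
    refine wsum_le_mul (fun a r => (a.tail.map Step.neg).reverse ++ r) fun w hs => ?_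
    obtain ⟨u, r, h1, h2, h3, h4⟩ := hs.split
    refine ⟨_, r, ?_, h3, h2, ?_⟩
    · simpa [h1, List.map_reverse] using (map_neg_neg u).symm
    · simp only [hw, ew]
      rw [← ENNReal.ofReal_mul (Real.exp_pos _).le, ← ENNReal.ofReal_mul (by positivity),
        ← Real.exp_add, ← Real.exp_add]
      refine ENNReal.ofReal_le_ofReal (Real.exp_le_exp.2 ?_)
      have h5 : (X w : ℝ) ≤ mx r := by exact_mod_cast h4
      have h6 : 0 ≤ lam * mx (Step.east :: u.reverse.map Step.neg) := by positivity
      have h7 := mul_le_mul_of_nonneg_left h5 hl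
      simp only [h1, List.length_append, List.length_cons, List.length_map, List.length_reverse,
        Nat.cast_add, Nat.cast_one] at *
      linarith
  refine ne_top_of_le_ne_top ?_ key
  rw [wsum_mul_left]
  exact ENNReal.mul_ne_top (ENNReal.mul_ne_top ENNReal.ofReal_ne_top hK) hK

/-! ### Unfolding levels of a bridge -/

/-- The levels of `w` straddled by a backtrack of size at least `d`. -/
noncomputable def bigLevels (d : ℤ) (w : Walk) : Finset ℤ :=
  (Finset.Icc 0 (X w)).filter fun l => Backtrack w l d

/-- The levels of `w` not straddled by a backtrack of size at least `d`. -/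
noncomputable def smallLevels (d : ℤ) (w : Walk) : Finset ℤ :=
  (Finset.Icc 0 (X w)).filter fun l => ¬Backtrack w l d

lemma card_levels {w : Walk} (h : Bridge w) (d : ℤ) :
    ((bigLevels d w).card : ℤ) + (smallLevels d w).card = X w + 1 := by
  have h0 := h.X_nonneg
  have := Finset.card_filter_add_card_filter_not (s := Finset.Icc 0 (X w))
    (fun l => Backtrack w l d)
  rw [Int.card_Icc] at this
  simp only [bigLevels, smallLevels]
  omega

lemma Backtrack.prepend {w : Walk} {l d : ℤ} (h : Backtrack w l d) (p : Walk) :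
    Backtrack (p ++ w) (l + X p) d := by
  obtain ⟨b, g, c, rfl, h1, h2, h3⟩ := h
  exact ⟨p ++ b, g, c, by simp, by simp; omega, by simp; omega, h3⟩

lemma card_bigLevels_le {b f c : Walk} {l d : ℤ} (hb : Bridge b) (hf : Bridge f)
    (h1 : X b - X f ≤ l) (hd : d ≤ X f) (h0 : 0 < d)
    (hl : ∀ k ∈ bigLevels d (b ++ f.map Step.flip ++ c), l ≤ k) :
    ((bigLevels d (b ++ f.map Step.flip ++ c)).card : ℤ) ≤ 2 * X f + (bigLevels d c).card := by
  set w := b ++ f.map Step.flip ++ c with hw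
  have hsub : bigLevels d w ⊆ Finset.Icc (X b - X f) (X b) ∪
      (bigLevels d c).map (addRightEmbedding (X b - X f)) := by
    intro k hk
    have hlk := hl k hk
    rw [Finset.mem_union, Finset.mem_Icc]
    rcases le_or_gt k (X b) with hkb | hkb
    · exact Or.inl ⟨by omega, hkb⟩
    right
    simp only [bigLevels, Finset.mem_filter, Finset.mem_Icc] at hk
    obtain ⟨⟨hk0, hkX⟩, b', g, c', e, h3, h4, h5⟩ := hk
    have hXw : X w = X b - X f + X c := by simp [hw]; ring
    have hlow : ∀ t, t <+: b ++ f.map Step.flip → X t ≤ X b := by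
      intro t ht
      rcases prefix_append_cases ht with ⟨r, rfl⟩ | ⟨v, hv, -, rfl⟩
      · have := hb.nonneg r (List.suffix_append _ _)
        simp only [X_append]
        omega
      · obtain ⟨v, hvf, rfl⟩ := List.prefix_map_iff.1 hv
        have := hf.pos v hvf
        rcases eq_or_ne v [] with rfl | hv0
        · simp
        · have := this hv0
          simp only [X_append, X_flip]
          omega
    rcases prefix_append_cases (u := b') (a := b ++ f.map Step.flip) (b := c)
      ⟨g ++ c', by rw [← hw, e, List.append_assoc]⟩ with h6 | ⟨v, ⟨r, hv⟩, -, rfl⟩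
    · have := hlow b' h6
      omega
    · have hr : r = g ++ c' := by
        have : b ++ f.map Step.flip ++ v ++ r = b ++ f.map Step.flip ++ v ++ (g ++ c') := by
          rw [List.append_assoc, hv, ← hw, e, List.append_assoc]
        exact List.append_cancel_left this
      simp only [X_append, X_flip] at h3 h4
      simp only [Finset.mem_map, addRightEmbedding_apply, bigLevels, Finset.mem_filter,
        Finset.mem_Icc]
      exact ⟨k - (X b - X f), ⟨⟨by omega, by omega⟩, v, g, c', by rw [← hv, hr]; simp,
        by omega, by omega, h5⟩, by ring⟩
  have := (Finset.card_le_card hsub).trans (Finset.card_union_le _ _)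
  rw [Finset.card_map, Int.card_Icc] at this
  omega

lemma card_smallLevels_le {b f c : Walk} {l d : ℤ} (h1 : X b - X f ≤ l) :
    ((smallLevels d (b ++ f.map Step.flip ++ c)).filter (l < ·)).card ≤
      (smallLevels d c).card := by
  rw [← Finset.card_map (s := smallLevels d c) (addRightEmbedding (X b - X f))]
  refine Finset.card_le_card fun k hk => ?_
  simp only [smallLevels, Finset.mem_filter, Finset.mem_Icc, Finset.mem_map,
    addRightEmbedding_apply, X_append, X_flip] at hk ⊢
  obtain ⟨⟨⟨hk0, hkX⟩, hn⟩, hlk⟩ := hk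
  refine ⟨k - (X b - X f), ⟨⟨by omega, by omega⟩, fun hc => hn ?_⟩, by ring⟩
  have := hc.prepend (b ++ f.map Step.flip)
  simp only [X_append, X_flip] at this
  convert this using 1
  ring

lemma one_add_pow_card (a : ℝ≥0∞) (S : Finset ℤ) :
    (1 + a) ^ S.card = 1 + ∑ l ∈ S, a * (1 + a) ^ (S.filter (l < ·)).card := by
  induction S using Finset.induction_on_min with
  | empty => simp
  | insert m S hm ih =>
    have hmS : m ∉ S := fun h => lt_irrefl _ (hm m h)
    have h1 : (insert m S).filter (m < ·) = S := by
      ext k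
      simp only [Finset.mem_filter, Finset.mem_insert]
      constructor
      · rintro ⟨rfl | h, h'⟩
        · exact absurd h' (lt_irrefl _)
        · exact h
      · exact fun h => ⟨Or.inr h, hm k h⟩
    have h2 : ∀ l ∈ S, (insert m S).filter (l < ·) = S.filter (l < ·) := by
      intro l hl
      rw [Finset.filter_insert, if_neg (hm l hl).le.not_gt]
    rw [Finset.card_insert_of_notMem hmS, Finset.sum_insert hmS, h1,
      Finset.sum_congr rfl fun l hl => by rw [h2 l hl], pow_succ, mul_add, mul_one]
    nth_rw 1 [ih]
    ring

lemma wsum_length_le_ne_top (P : Walk → Prop) (f : Walk → ℝ≥0∞) (hf : ∀ w, f w ≠ ⊤) (n : ℕ) :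
    wsum (fun w => P w ∧ w.length ≤ n) f ≠ ⊤ := by
  have : Finite {w : Walk // P w ∧ w.length ≤ n} :=
    ((List.finite_length_le Step n).subset fun _ h => h.2).to_subtype
  have := Fintype.ofFinite {w : Walk // P w ∧ w.length ≤ n}
  rw [wsum, tsum_fintype]
  exact ENNReal.sum_ne_top.2 fun w _ => hf w.1

lemma le_two_mul_of_le_add {T A c : ℝ≥0∞} (hT : T ≠ ⊤) (hc : c ≤ 1 / 2) (h : T ≤ A + c * T) :
    T ≤ 2 * A := by
  have h1 : 2 * T ≤ 2 * A + T := by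
    calc 2 * T ≤ 2 * (A + 1 / 2 * T) := by gcongr; exact h.trans (by gcongr)
      _ = 2 * A + T := by
        rw [mul_add, ← mul_assoc, one_div, ENNReal.mul_inv_cancel two_ne_zero ENNReal.ofNat_ne_top,
          one_mul]
  rw [two_mul] at h1
  exact (ENNReal.add_le_add_iff_right hT).1 h1

/-- Exponential moments of the number of levels with large backtracks. -/
lemma wsum_bigLevels_ne_top {lam s : ℝ} (hl : 0 ≤ lam) (hG : wsum Bridge (ew lam s) ≠ ⊤) {d : ℤ}
    (hd : 0 < d) (hP : wsum Bridge (ew lam s) *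
      wsum (fun w => Bridge w ∧ d ≤ X w) (ew lam s) ≤ 1 / 2) :
    wsum Bridge (fun w => ew lam s w *
      ENNReal.ofReal (Real.exp (lam * (bigLevels d w).card))) ≠ ⊤ := by
  set T : Walk → ℝ≥0∞ := fun w =>
    ew lam s w * ENNReal.ofReal (Real.exp (lam * (bigLevels d w).card)) with hT
  refine ne_top_of_le_ne_top (ENNReal.mul_ne_top ENNReal.ofNat_ne_top hG)
    (wsum_le_of_forall_le (K := 2 * wsum Bridge (ew lam s)) List.length fun n => ?_)
  refine le_two_mul_of_le_add (wsum_length_le_ne_top _ _ (fun w => ?_) n) hP ?_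
  · exact ENNReal.mul_ne_top (ew_ne_top _ _ _) ENNReal.ofReal_ne_top
  refine (wsum_le_add (Q := fun w => (Bridge w ∧ w.length ≤ n) ∧ bigLevels d w = ∅)
    (R := fun w => (Bridge w ∧ w.length ≤ n) ∧ bigLevels d w ≠ ∅) _ fun w hw => ?_).trans
    (add_le_add ?_ ?_)
  · by_cases h : bigLevels d w = ∅
    · exact Or.inl ⟨hw, h⟩
    · exact Or.inr ⟨hw, h⟩
  · exact wsum_mono fun w hw => ⟨hw.1.1, by simp [hT, hw.2]⟩
  · refine wsum_le_mul₃ (fun b f c => b ++ f.map Step.flip ++ c) fun w ⟨⟨hw, hwn⟩, hne⟩ => ?_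
    have hne' := Finset.nonempty_iff_ne_empty.2 hne
    set l := (bigLevels d w).min' hne' with hl'
    have hmem := Finset.min'_mem _ hne'
    rw [← hl'] at hmem
    have hmin : ∀ k ∈ bigLevels d w, l ≤ k := fun k hk => Finset.min'_le _ k hk
    obtain ⟨⟨hl0, hlX⟩, hbt⟩ : (0 ≤ l ∧ l ≤ X w) ∧ Backtrack w l d := by
      simpa [bigLevels] using hmem
    obtain ⟨b, f, c, hw', hb, hf, hc, h1, h2, h3⟩ := exists_unfold hw l hl0 hlX
    have hdf := h3 d hbt
    have hlen : w.length = b.length + f.length + c.length := by simp [hw', add_assoc]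
    refine ⟨b, f, c, hw', hb, ⟨hf, hdf⟩, ⟨hc, by omega⟩, ?_⟩
    rw [hw'] at hmin
    have hcard := card_bigLevels_le hb hf h2 hdf hd hmin
    rw [← hw'] at hcard
    have hX : X w = X b - X f + X c := by simp [hw']; ring
    simp only [hT, ew]
    rw [← ENNReal.ofReal_mul (Real.exp_pos _).le, ← ENNReal.ofReal_mul (Real.exp_pos _).le,
      ← ENNReal.ofReal_mul (Real.exp_pos _).le, ← ENNReal.ofReal_mul (by positivity),
      ← Real.exp_add, ← Real.exp_add, ← Real.exp_add, ← Real.exp_add]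
    refine ENNReal.ofReal_le_ofReal (Real.exp_le_exp.2 ?_)
    have hcard' : ((bigLevels d w).card : ℝ) ≤ 2 * X f + (bigLevels d c).card := by
      exact_mod_cast hcard
    have := mul_le_mul_of_nonneg_left hcard' hl
    rw [hX, hlen]
    push_cast
    linarith

/-- Exponential moments of the number of levels without large backtracks. -/
lemma wsum_smallLevels_ne_top {s : ℝ} (hq : q 0 s < 1) {a : ℝ≥0∞} (ha : a ≠ ⊤) (d : ℕ)
    (hP : a * d * (1 - q 0 s)⁻¹ * (d + 1) ≤ 1 / 2) :
    wsum Bridge (fun w => ew 0 s w * (1 + a) ^ (smallLevels d w).card) ≠ ⊤ := by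
  have hG : wsum Bridge (ew 0 s) ≠ ⊤ := by
    rw [wsum_bridge_eq, ENNReal.inv_ne_top]
    exact (tsub_pos_of_lt hq).ne'
  refine ne_top_of_le_ne_top (ENNReal.mul_ne_top ENNReal.ofNat_ne_top hG)
    (wsum_le_of_forall_le (K := 2 * wsum Bridge (ew 0 s)) List.length fun n => ?_)
  refine le_two_mul_of_le_add (wsum_length_le_ne_top _ _ (fun w => ?_) n) hP ?_
  · exact ENNReal.mul_ne_top (ew_ne_top _ _ _)
      (ENNReal.pow_ne_top (ENNReal.add_ne_top.2 ⟨ENNReal.one_ne_top, ha⟩))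
  set T : Walk → ℝ≥0∞ := fun w => ew 0 s w * (1 + a) ^ (smallLevels d w).card with hT
  let W := {w : Walk // Bridge w ∧ w.length ≤ n}
  let B := {w : Walk // Bridge w}
  let F := {w : Walk // Bridge w ∧ X w ≤ d}
  have e1 : wsum (fun w => Bridge w ∧ w.length ≤ n) T = ∑' w : W, ew 0 s w.1 +
      ∑' p : (Σ w : W, {l // l ∈ smallLevels d w.1}), ew 0 s p.1.1 *
        (a * (1 + a) ^ ((smallLevels d p.1.1).filter (p.2.1 < ·)).card) := by
    rw [ENNReal.tsum_sigma', ← ENNReal.tsum_add]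
    refine tsum_congr fun w => ?_
    simp only [hT]
    rw [one_add_pow_card, mul_add, mul_one, Finset.mul_sum]
    congr 1
    exact (Finset.tsum_subtype (smallLevels d w.1) fun l => ew 0 s w.1 *
      (a * (1 + a) ^ ((smallLevels d w.1).filter (l < ·)).card)).symm
  refine e1.le.trans ?_
  refine add_le_add (wsum_mono (Q := Bridge) fun w hw => ⟨hw.1, le_rfl⟩) ?_
  have e2 : ∑' p : B × F × W × Fin d, ew 0 s p.1.1 * (ew 0 s p.2.1.1 *
      (T p.2.2.1.1 * a)) = wsum Bridge (ew 0 s) * (wsum (fun w => Bridge w ∧ X w ≤ d) (ew 0 s) *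
        (wsum (fun w => Bridge w ∧ w.length ≤ n) T * (d * a))) := by
    have h (b f : Walk) : ∑' w : W, (d : ℝ≥0∞) * (ew 0 s b * (ew 0 s f * (T w.1 * a))) =
        ew 0 s b * (ew 0 s f * (wsum (fun w => Bridge w ∧ w.length ≤ n) T * (d * a))) := by
      rw [wsum, ← ENNReal.tsum_mul_right, ← ENNReal.tsum_mul_left, ← ENNReal.tsum_mul_left]
      refine tsum_congr fun w => ?_
      ring
    simp_rw [ENNReal.tsum_prod', tsum_fintype, Finset.sum_const, Finset.card_univ, Fintype.card_fin,
      nsmul_eq_mul, h, ENNReal.tsum_mul_left, ENNReal.tsum_mul_right]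
    rfl
  calc _ ≤ ∑' p : B × F × W × Fin d, ew 0 s p.1.1 * (ew 0 s p.2.1.1 * (T p.2.2.1.1 * a)) := ?_
    _ = wsum Bridge (ew 0 s) * (wsum (fun w => Bridge w ∧ X w ≤ d) (ew 0 s) *
        (wsum (fun w => Bridge w ∧ w.length ≤ n) T * (d * a))) := e2
    _ ≤ wsum Bridge (ew 0 s) * ((d + 1) *
        (wsum (fun w => Bridge w ∧ w.length ≤ n) T * (d * a))) := by
      gcongr
      exact wsum_bridge_X_le s hq.le d
    _ = _ := by rw [wsum_bridge_eq]; ring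
  refine tsum_le_tsum_of_rel (fun p r => p.1.1 = r.1.1 ++ r.2.1.1.map Step.flip ++ r.2.2.1.1 ∧
    p.2.1 = r.2.2.2.1 + X r.1.1 - X r.2.1.1) ?_ ?_
  · rintro ⟨⟨w, hw, hwn⟩, ⟨l, hl⟩⟩
    obtain ⟨⟨hl0, hlX⟩, hbt⟩ : (0 ≤ l ∧ l ≤ X w) ∧ ¬Backtrack w l d := by
      simpa [smallLevels] using hl
    obtain ⟨b, f, c, hw', hb, hf, hc, h1, h2, -⟩ := exists_unfold hw l hl0 hlX
    have hfd : X f < d := by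
      by_contra hcon
      exact hbt ⟨b, f.map Step.flip, c, hw', h1, by rw [X_flip]; omega, by rw [X_flip]; omega⟩
    have hlen : w.length = b.length + f.length + c.length := by simp [hw', add_assoc]
    refine ⟨(⟨b, hb⟩, ⟨f, hf, hfd.le⟩, ⟨c, hc, by omega⟩, ⟨(l - X b + X f).toNat, by omega⟩),
      ⟨hw', by simp only; omega⟩, ?_⟩
    have hcard := card_smallLevels_le (c := c) (d := d) h2
    rw [← hw'] at hcard
    calc ew 0 s w * (a * (1 + a) ^ ((smallLevels d w).filter (l < ·)).card)
        ≤ ew 0 s w * (a * (1 + a) ^ (smallLevels d c).card) := by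
          gcongr
          exact self_le_add_right 1 a
      _ = _ := by
        have hew : ew 0 s w = ew 0 s b * ew 0 s f * ew 0 s c := by rw [hw']; simp [mul_assoc]
        rw [hew]
        simp only [hT]
        ring
  · rintro ⟨⟨w, hw⟩, ⟨l, hl⟩⟩ ⟨⟨w', hw'⟩, ⟨l', hl'⟩⟩ r ⟨h1, h2⟩ ⟨h3, h4⟩
    obtain rfl : w = w' := h1.trans h3.symm
    obtain rfl : l = l' := h2.trans h4.symm
    rfl

/-! ### Positive speed forces a finite mean for irreducible bridges -/

lemma exists_good_bad {v : ℝ} (h : ¬Bad v) {δ : ℝ} (hδ : 0 < δ) :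
    ∃ u, v ≤ u ∧ ¬Bad u ∧ Bad (u + δ) := by
  by_contra hc
  push Not at hc
  have key : ∀ n : ℕ, ¬Bad (v + n * δ) := by
    intro n
    induction n with
    | zero => simpa using h
    | succ n ih =>
      have h1 : 0 ≤ n * δ := by positivity
      have := hc (v + n * δ) (by linarith) ih
      rwa [show v + ((n + 1 : ℕ) : ℝ) * δ = v + n * δ + δ by push_cast; ring]
  obtain ⟨n, hn⟩ := exists_nat_gt ((2 - v) / δ)
  rw [div_lt_iff₀ hδ] at hn
  exact key n (bad_two.mono (by linarith))

lemma exists_tail_le {P : Walk → Prop} {f : Walk → ℝ≥0∞} (h : wsum P f ≠ ⊤) (m : Walk → ℕ)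
    {ε : ℝ≥0∞} (hε : 0 < ε) : ∃ n, wsum (fun w => P w ∧ n ≤ m w) f ≤ ε := by
  have h1 := ENNReal.tendsto_tsum_compl_atTop_zero h
  obtain ⟨t, ht⟩ := ((ENNReal.tendsto_nhds_zero.1 h1) ε hε).exists
  refine ⟨t.sup (fun w => m w.1) + 1, le_trans ?_ ht⟩
  refine tsum_le_tsum_of_rel (fun a b => a.1 = b.1.1) (fun a => ?_)
    (fun _ _ _ h h' => Subtype.ext (h.trans h'.symm))
  refine ⟨⟨⟨a.1, a.2.1⟩, fun hmem => ?_⟩, rfl, le_rfl⟩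
  have := Finset.le_sup (f := fun w : {w // P w} => m w.1) hmem
  have := a.2.2
  simp only at *
  omega

lemma bad_of_wsum_levels {v lam δ θ κ a : ℝ} {d : ℤ} (hl : 0 < lam) (hδ : 0 < δ) (ha : 0 ≤ a)
    (h1 : wsum Bridge (fun w => ew lam (sig + lam * (v + δ + δ)) w *
      ENNReal.ofReal (Real.exp (lam * (bigLevels d w).card))) ≠ ⊤)
    (h2 : wsum Bridge (fun w => ew 0 (sig + θ) w *
      (1 + ENNReal.ofReal a) ^ (smallLevels d w).card) ≠ ⊤)
    (hκ : κ = v - 3 * δ) (h : θ < κ * Real.log (1 + a)) : Bad v := by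
  set η := min (lam * δ) (κ * Real.log (1 + a) - θ) with hη
  have hη1 : η ≤ lam * δ := min_le_left _ _
  have hη2 : η ≤ κ * Real.log (1 + a) - θ := min_le_right _ _
  have hlog : 0 ≤ Real.log (1 + a) := Real.log_nonneg (by linarith)
  refine ⟨η, lt_min (by positivity) (by linarith), ?_⟩
  refine ne_top_of_le_ne_top (ENNReal.add_ne_top.2 ⟨h1, h2⟩) ((wsum_le_add
    (Q := fun w => (Bridge w ∧ v * w.length ≤ X w) ∧ 3 * δ * w.length ≤ (bigLevels d w).card)
    (R := fun w => (Bridge w ∧ v * w.length ≤ X w) ∧ (bigLevels d w).card < 3 * δ * w.length)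
    _ fun w hw => ?_).trans (add_le_add ?_ ?_))
  · rcases le_or_gt (3 * δ * w.length) (bigLevels d w).card with h | h
    · exact Or.inl ⟨hw, h⟩
    · exact Or.inr ⟨hw, h⟩
  · refine wsum_mono fun w ⟨⟨hb, hX⟩, hU⟩ => ⟨hb, ?_⟩
    rw [ew, ew, ← ENNReal.ofReal_mul (Real.exp_pos _).le, ← Real.exp_add]
    refine ENNReal.ofReal_le_ofReal (Real.exp_le_exp.2 ?_)
    have hL : (0 : ℝ) ≤ w.length := Nat.cast_nonneg _
    have e1 := mul_le_mul_of_nonneg_left hX hl.le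
    have e2 := mul_le_mul_of_nonneg_left hU hl.le
    have e3 := mul_le_mul_of_nonneg_right hη1 hL
    linarith
  · refine wsum_mono fun w ⟨⟨hb, hX⟩, hU⟩ => ⟨hb, ?_⟩
    have hL : (0 : ℝ) ≤ w.length := Nat.cast_nonneg _
    have hc : ((bigLevels d w).card : ℝ) + (smallLevels d w).card = X w + 1 := by
      exact_mod_cast card_levels hb d
    have hV : κ * w.length ≤ (smallLevels d w).card := by
      rw [hκ]
      linarith
    have e0 : (1 + ENNReal.ofReal a) ^ (smallLevels d w).card =
        ENNReal.ofReal (Real.exp (Real.log (1 + a) * (smallLevels d w).card)) := by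
      rw [← ENNReal.ofReal_one, ← ENNReal.ofReal_add zero_le_one ha,
        ← ENNReal.ofReal_pow (by linarith), mul_comm, Real.exp_nat_mul,
        Real.exp_log (by linarith)]
    rw [e0, ew, ew, ← ENNReal.ofReal_mul (Real.exp_pos _).le, ← Real.exp_add]
    refine ENNReal.ofReal_le_ofReal (Real.exp_le_exp.2 ?_)
    have e1 := mul_le_mul_of_nonneg_left hV hlog
    have e2 := mul_le_mul_of_nonneg_right hη2 hL
    linarith

lemma one_sub_q_le {v₀ : ℝ} (hv₀ : 0 < v₀) (hgood : ¬Bad v₀) :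
    ∃ C : ℝ, ∀ θ > 0, 1 - (q 0 (sig + θ)).toReal ≤ C * θ := by
  set δ := v₀ / 6 with hδ
  have hδ0 : 0 < δ := by positivity
  obtain ⟨v, hv, hg, hb⟩ := exists_good_bad hgood hδ0
  obtain ⟨lam, hl, hG⟩ := hb.wsum_ne_top (by linarith) hδ0
  set G := wsum Bridge (ew lam (sig + lam * (v + δ + δ))) with hGdef
  have hG1 : G ≠ 0 := by
    rw [hGdef, wsum_bridge_eq]
    exact ENNReal.inv_ne_zero.2 (ne_top_of_le_ne_top ENNReal.one_ne_top tsub_le_self)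
  obtain ⟨n, hn⟩ := exists_tail_le hG (fun w => (X w).toNat) (ε := 1 / 2 / G)
    (ENNReal.div_pos (by simp) hG)
  set d := n + 1 with hd
  have hU := wsum_bigLevels_ne_top (d := d) hl.le hG (by omega) (by
    refine (mul_le_mul' le_rfl ((wsum_mono fun w hw => ⟨⟨hw.1, ?_⟩, le_rfl⟩).trans hn)).trans
      ENNReal.mul_div_le
    have := hw.2
    omega)
  refine ⟨8 * (d * (d + 1)) / v₀, fun θ hθ => ?_⟩
  have hq : q 0 (sig + θ) < 1 := q_lt_one (by linarith)
  have hqt : q 0 (sig + θ) ≠ ⊤ := hq.ne_top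
  set x := 1 - (q 0 (sig + θ)).toReal with hx
  have hx0 : 0 < x := by
    have := (ENNReal.toReal_lt_toReal hqt ENNReal.one_ne_top).2 hq
    rw [ENNReal.toReal_one] at this
    linarith
  have hx1 : x ≤ 1 := by
    have : 0 ≤ (q 0 (sig + θ)).toReal := ENNReal.toReal_nonneg
    linarith
  have hxe : 1 - q 0 (sig + θ) = ENNReal.ofReal x := by
    rw [hx, ENNReal.ofReal_sub _ ENNReal.toReal_nonneg, ENNReal.ofReal_one,
      ENNReal.ofReal_toReal hqt]
  have hd0 : (1 : ℝ) ≤ d := by rw [hd]; push_cast; linarith [(Nat.cast_nonneg n : (0 : ℝ) ≤ n)]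
  have hdd : (0 : ℝ) < d * (d + 1) := by positivity
  set a := x / (2 * (d * (d + 1))) with ha
  have ha0 : 0 < a := by positivity
  have ha1 : a ≤ 1 := by
    rw [ha, div_le_one (by positivity)]
    nlinarith
  have hV := wsum_smallLevels_ne_top hq (a := ENNReal.ofReal a) ENNReal.ofReal_ne_top d (by
    rw [hxe, ← ENNReal.ofReal_inv_of_pos hx0, ← ENNReal.ofReal_natCast, ← ENNReal.ofReal_one,
      ← ENNReal.ofReal_add (by positivity) zero_le_one, ← ENNReal.ofReal_mul ha0.le,
      ← ENNReal.ofReal_mul (by positivity), ← ENNReal.ofReal_mul (by positivity),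
      ENNReal.ofReal_one, show (1 : ℝ≥0∞) / 2 = ENNReal.ofReal (1 / 2) by
        rw [ENNReal.ofReal_div_of_pos two_pos]
        simp]
    refine ENNReal.ofReal_le_ofReal (le_of_eq ?_)
    rw [ha]
    field_simp)
  by_contra hcon
  push Not at hcon
  refine hg (bad_of_wsum_levels hl hδ0 ha0.le hU hV rfl ?_)
  have hlog : a / 2 ≤ Real.log (1 + a) := by
    refine le_trans ?_ (Real.le_log_one_add_of_nonneg ha0.le)
    rw [le_div_iff₀ (by linarith)]
    nlinarith
  have hκ : v₀ / 2 ≤ v - 3 * δ := by rw [hδ]; linarith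
  calc θ < v₀ / 2 * (a / 2) := by
        rw [ha]
        rw [div_mul_eq_mul_div, div_lt_iff₀ hv₀] at hcon
        field_simp
        linarith
    _ ≤ (v - 3 * δ) * Real.log (1 + a) := by gcongr; linarith

/-- The weight of an irreducible bridge at criticality. -/
noncomputable def pr (b : I) : ℝ := Real.exp (-sig * b.1.length)

lemma pr_pos (b : I) : 0 < pr b := Real.exp_pos _

lemma ew_sig (b : I) : ew 0 sig b.1 = ENNReal.ofReal (pr b) := by simp [ew, pr]

lemma q_sig {C : ℝ} (hC : ∀ θ > 0, 1 - (q 0 (sig + θ)).toReal ≤ C * θ) : q 0 sig = 1 := by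
  apply le_antisymm
  · rw [q, ENNReal.tsum_eq_iSup_sum]
    refine iSup_le fun t => ?_
    have h1 : Tendsto (fun θ => ∑ b ∈ t, ew 0 (sig + θ) b.1) (𝓝[>] 0)
        (𝓝 (∑ b ∈ t, ew 0 sig b.1)) := by
      refine tendsto_finsetSum _ fun b _ => ?_
      have : Continuous fun θ : ℝ => ew 0 (sig + θ) b.1 := by
        unfold ew
        exact ENNReal.continuous_ofReal.comp (by fun_prop)
      have h := this.tendsto 0
      simp only [add_zero] at h
      exact h.mono_left nhdsWithin_le_nhds
    refine le_of_tendsto h1 (Filter.mem_of_superset self_mem_nhdsWithin fun θ hθ => ?_)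
    exact (ENNReal.sum_le_tsum t).trans (q_lt_one (by simpa using hθ)).le
  · have h1 : ∀ θ > 0, ENNReal.ofReal (1 - C * θ) ≤ q 0 sig := by
      intro θ hθ
      have h2 : q 0 (sig + θ) ≤ q 0 sig := ENNReal.tsum_le_tsum fun b => ew_le_ew (by
        have : (0 : ℝ) ≤ θ * b.1.length := by positivity
        linarith)
      refine le_trans ?_ h2
      rw [← ENNReal.ofReal_toReal (q_lt_one (show sig < sig + θ by linarith)).ne_top]
      exact ENNReal.ofReal_le_ofReal (by linarith [hC θ hθ])
    have h2 : Tendsto (fun θ : ℝ => ENNReal.ofReal (1 - C * θ)) (𝓝[>] 0) (𝓝 1) := by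
      have : Continuous fun θ : ℝ => ENNReal.ofReal (1 - C * θ) :=
        ENNReal.continuous_ofReal.comp (by fun_prop)
      have h := this.tendsto 0
      simp only [mul_zero, sub_zero, ENNReal.ofReal_one] at h
      exact h.mono_left nhdsWithin_le_nhds
    exact le_of_tendsto h2 (Filter.mem_of_superset self_mem_nhdsWithin fun θ hθ => h1 θ hθ)

lemma hasSum_pr (h : q 0 sig = 1) : HasSum pr 1 := by
  have h1 : ∑' b, ENNReal.ofReal (pr b) = 1 := by simpa only [q, ew_sig] using h
  have h2 : Summable pr := by
    have := ENNReal.summable_toReal (f := fun b => ENNReal.ofReal (pr b)) (by rw [h1]; simp)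
    simpa [ENNReal.toReal_ofReal (pr_pos _).le] using this
  have h3 := ENNReal.ofReal_tsum_of_nonneg (fun b => (pr_pos b).le) h2
  rw [h1, ENNReal.ofReal_eq_one] at h3
  exact h3 ▸ h2.hasSum

lemma summable_pr_mul {C : ℝ} (hC : ∀ θ > 0, 1 - (q 0 (sig + θ)).toReal ≤ C * θ) :
    Summable fun b => pr b * b.1.length := by
  have hq := q_sig hC
  refine summable_of_sum_le (c := 2 * C) (fun b => by have := pr_pos b; positivity) fun t => ?_
  obtain ⟨M, hM⟩ : ∃ M : ℕ, ∀ b ∈ t, b.1.length ≤ M :=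
    ⟨t.sup fun b => b.1.length, fun b hb => Finset.le_sup (f := fun b : I => b.1.length) hb⟩
  set θ : ℝ := 1 / (M + 1) with hθ
  have hθ0 : 0 < θ := by positivity
  have hθL : ∀ b ∈ t, θ * b.1.length ≤ 1 := fun b hb => by
    rw [hθ, one_div_mul_eq_div, div_le_one (by positivity)]
    have : (b.1.length : ℝ) ≤ M := by exact_mod_cast hM b hb
    linarith
  have h0 : ∀ b : I, 0 ≤ 1 - Real.exp (-θ * b.1.length) := fun b => by
    rw [sub_nonneg, Real.exp_le_one_iff]
    have : 0 ≤ θ * b.1.length := by positivity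
    linarith
  set D : I → ℝ≥0∞ := fun b => ENNReal.ofReal (pr b * (1 - Real.exp (-θ * b.1.length))) with hD
  have hsum : ∑' b, D b + q 0 (sig + θ) = 1 := by
    rw [← hq, q, q, ← ENNReal.tsum_add]
    refine tsum_congr fun b => ?_
    rw [ew_sig, hD, ew, ← ENNReal.ofReal_add (mul_nonneg (pr_pos b).le (h0 b)) (Real.exp_pos _).le]
    congr 1
    rw [mul_sub, pr, ← Real.exp_add]
    ring_nf
  have hsum' : (∑' b, D b).toReal = 1 - (q 0 (sig + θ)).toReal := by
    have h1 : ∑' b, D b ≠ ⊤ := ne_top_of_le_ne_top ENNReal.one_ne_top (hsum ▸ le_self_add)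
    have h2 : q 0 (sig + θ) ≠ ⊤ := ne_top_of_le_ne_top ENNReal.one_ne_top (hsum ▸ le_add_self)
    have := congrArg ENNReal.toReal hsum
    rw [ENNReal.toReal_add h1 h2, ENNReal.toReal_one] at this
    linarith
  have h1 : ∑ b ∈ t, pr b * (1 - Real.exp (-θ * b.1.length)) ≤ C * θ := by
    have h2 : ∑' b, D b ≠ ⊤ := ne_top_of_le_ne_top ENNReal.one_ne_top (hsum ▸ le_self_add)
    have h3 := ENNReal.toReal_mono h2 (ENNReal.sum_le_tsum t)
    rw [hsum', hD, ← ENNReal.ofReal_sum_of_nonneg fun b _ => mul_nonneg (pr_pos b).le (h0 b),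
      ENNReal.toReal_ofReal (Finset.sum_nonneg fun b _ => mul_nonneg (pr_pos b).le (h0 b))] at h3
    exact h3.trans (hC θ hθ0)
  have h2 : ∀ b ∈ t, pr b * b.1.length * (θ / 2) ≤ pr b * (1 - Real.exp (-θ * b.1.length)) := by
    intro b hb
    rw [mul_assoc]
    refine mul_le_mul_of_nonneg_left ?_ (pr_pos b).le
    have h3 := hθL b hb
    have h4 : 0 ≤ θ * b.1.length := by positivity
    rw [neg_mul, Real.exp_neg]
    have h5 : (Real.exp (θ * b.1.length))⁻¹ ≤ (1 + θ * b.1.length)⁻¹ :=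
      inv_anti₀ (by positivity) (by linarith [Real.add_one_le_exp (θ * b.1.length)])
    have h6 : (1 + θ * b.1.length)⁻¹ ≤ 1 - θ * b.1.length / 2 := by
      rw [inv_le_iff_one_le_mul₀ (by positivity)]
      nlinarith
    linarith
  have h3 := (Finset.sum_le_sum h2).trans h1
  rw [← Finset.sum_mul] at h3
  have h4 : (∑ b ∈ t, pr b * b.1.length) * (θ / 2) ≤ 2 * C * (θ / 2) := by linarith
  exact le_of_mul_le_mul_right h4 (by positivity)

/-! ### Laws of large numbers -/

section LLN

open MeasureTheory ProbabilityTheory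

variable {α : Type*} [Countable α]

lemma integrable_toMeasure_of_summable [MeasurableSpace α] [MeasurableSingletonClass α] (P : PMF α)
    (f : α → ℝ) (hf : Summable fun a => (P a).toReal * |f a|) : Integrable f P.toMeasure := by
  have hm : Measurable f := measurable_of_countable f
  refine ⟨hm.aestronglyMeasurable, ?_⟩
  rw [hasFiniteIntegral_iff_norm, lintegral_countable']
  have h1 : ∀ a, ENNReal.ofReal ‖f a‖ * P.toMeasure {a} =
      ENNReal.ofReal ((P a).toReal * |f a|) := fun a => by
    rw [P.toMeasure_apply_singleton a (measurableSet_singleton a),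
      ENNReal.ofReal_mul ENNReal.toReal_nonneg, ENNReal.ofReal_toReal (P.apply_ne_top a), mul_comm,
      Real.norm_eq_abs]
  simp_rw [h1]
  rw [← ENNReal.ofReal_tsum_of_nonneg (fun a => by positivity) hf]
  exact ENNReal.ofReal_lt_top

lemma ae_tendsto_average [MeasurableSpace α] [MeasurableSingletonClass α] (P : PMF α)
    (f : α → ℝ) (hf : Summable fun a => (P a).toReal * |f a|) :
    ∀ᵐ ω : ℕ → α ∂(Measure.infinitePi fun _ => P.toMeasure),
      Tendsto (fun n : ℕ => (∑ i ∈ Finset.range n, f (ω i)) / n) atTop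
        (𝓝 (∑' a, (P a).toReal * f a)) := by
  have hm : Measurable f := measurable_of_countable f
  have hi := integrable_toMeasure_of_summable P f hf
  have hmap : ∀ i, MeasurePreserving (fun ω : ℕ → α => ω i)
      (Measure.infinitePi fun _ => P.toMeasure) P.toMeasure := fun i =>
    measurePreserving_eval_infinitePi (fun _ : ℕ => P.toMeasure) i
  have hind := iIndepFun_infinitePi (P := fun _ : ℕ => P.toMeasure) (X := fun _ => f) fun _ => hm
  have h := strong_law_ae_real (μ := Measure.infinitePi fun _ : ℕ => P.toMeasure)
    (fun i ω => f (ω i)) ((hmap 0).integrable_comp_of_integrable hi)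
    (fun i j hij => hind.indepFun hij) (fun i =>
      ⟨(hm.comp (measurable_pi_apply i)).aemeasurable,
       (hm.comp (measurable_pi_apply 0)).aemeasurable, by
        have e : ∀ j : ℕ, Measure.map (fun ω : ℕ → α => f (ω j))
            (Measure.infinitePi fun _ => P.toMeasure) = Measure.map f P.toMeasure := fun j => by
          conv_rhs => rw [← (hmap j).map_eq, Measure.map_map hm (measurable_pi_apply j)]
          rfl
        rw [e i, e 0]⟩)
  have e : ∫ ω : ℕ → α, f (ω 0) ∂(Measure.infinitePi fun _ => P.toMeasure) =
      ∑' a, (P a).toReal * f a := by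
    rw [← integral_map (φ := fun ω : ℕ → α => ω 0) (measurable_pi_apply 0).aemeasurable
      hm.aestronglyMeasurable, (hmap 0).map_eq, PMF.integral_eq_tsum P f hi]
    rfl
  rwa [e] at h

/-- The law of large numbers, phrased in terms of finite lists: with uniformly positive probability
the empirical means of `f` and `g` are close to their expectations from time `n₀` on. -/
lemma exists_uniform_lln (p : α → ℝ) (hp : ∀ a, 0 ≤ p a) (h1 : HasSum p 1) (f g : α → ℝ)
    (hf : Summable fun a => p a * |f a|) (hg : Summable fun a => p a * |g a|) {ε : ℝ} (hε : 0 < ε) :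
    ∃ n₀ : ℕ, ∃ c : ℝ≥0∞, 0 < c ∧ ∀ k, c ≤ ∑' l : {l : List α // l.length = k ∧
      ∀ l₁, l₁ <+: l → n₀ ≤ l₁.length →
        |(l₁.map f).sum - (∑' a, p a * f a) * l₁.length| ≤ ε * l₁.length ∧
        |(l₁.map g).sum - (∑' a, p a * g a) * l₁.length| ≤ ε * l₁.length},
      (l.1.map fun a => ENNReal.ofReal (p a)).prod := by
  let _ : MeasurableSpace α := ⊤
  have : MeasurableSingletonClass α := ⟨fun _ => trivial⟩
  let P : PMF α := ⟨fun a => ENNReal.ofReal (p a), by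
    have := ENNReal.ofReal_tsum_of_nonneg hp h1.summable
    rw [h1.tsum_eq, ENNReal.ofReal_one] at this
    rw [this]
    exact ENNReal.summable.hasSum⟩
  have hP : ∀ a, P a = ENNReal.ofReal (p a) := fun a => rfl
  have hP' : ∀ a, (P a).toReal = p a := fun a => by rw [hP, ENNReal.toReal_ofReal (hp a)]
  set μ : Measure (ℕ → α) := Measure.infinitePi fun _ => P.toMeasure with hμ
  have hf' := ae_tendsto_average P f (by simpa only [hP'] using hf)
  have hg' := ae_tendsto_average P g (by simpa only [hP'] using hg)
  simp only [hP'] at hf' hg'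
  set mf := ∑' a, p a * f a
  set mg := ∑' a, p a * g a
  let E : ℕ → Set (ℕ → α) := fun n₀ => {ω | ∀ n : ℕ, n₀ ≤ n →
    |∑ i ∈ Finset.range n, f (ω i) - mf * n| ≤ ε * n ∧
    |∑ i ∈ Finset.range n, g (ω i) - mg * n| ≤ ε * n}
  have hE : ∀ (h : α → ℝ) (m : ℝ) (ω : ℕ → α),
      Tendsto (fun n : ℕ => (∑ i ∈ Finset.range n, h (ω i)) / n) atTop (𝓝 m) →
      ∀ᶠ n : ℕ in atTop, |∑ i ∈ Finset.range n, h (ω i) - m * n| ≤ ε * n := by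
    intro h m ω hω
    filter_upwards [(Metric.tendsto_nhds.1 hω) ε hε, eventually_gt_atTop 0] with n hn hn0
    have hn0' : (0 : ℝ) < n := by exact_mod_cast hn0
    rw [Real.dist_eq] at hn
    have : ∑ i ∈ Finset.range n, h (ω i) - m * n =
        ((∑ i ∈ Finset.range n, h (ω i)) / n - m) * n := by field_simp
    rw [this, abs_mul, abs_of_pos hn0']
    exact mul_le_mul_of_nonneg_right hn.le hn0'.le
  have hU : μ (⋃ n, E n) ≠ 0 := by
    intro h0
    have h2 : ∀ᵐ ω ∂μ, ω ∈ ⋃ n, E n := by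
      filter_upwards [hf', hg'] with ω h1 h2
      obtain ⟨n, hn⟩ := eventually_atTop.1 ((hE f mf ω h1).and (hE g mg ω h2))
      exact Set.mem_iUnion.2 ⟨n, hn⟩
    have h3 : ∀ᵐ ω ∂μ, ω ∉ ⋃ n, E n := measure_eq_zero_iff_ae_notMem.1 h0
    obtain ⟨ω, h4, h5⟩ := (h2.and h3).exists
    exact h5 h4
  obtain ⟨n₀, hn₀⟩ : ∃ n, μ (E n) ≠ 0 := by
    by_contra! h
    exact hU (measure_iUnion_null_iff.2 h)
  refine ⟨n₀, μ (E n₀), pos_iff_ne_zero.2 hn₀, fun k => ?_⟩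
  have hsub : E n₀ ⊆ ⋃ l : {l : List α // l.length = k ∧ ∀ l₁, l₁ <+: l → n₀ ≤ l₁.length →
        |(l₁.map f).sum - mf * l₁.length| ≤ ε * l₁.length ∧
        |(l₁.map g).sum - mg * l₁.length| ≤ ε * l₁.length},
      (Finset.range k : Set ℕ).pi fun i => {x | l.1[i]? = some x} := by
    intro ω hω
    refine Set.mem_iUnion.2 ⟨⟨(List.range k).map ω, by simp, fun l₁ hl₁ hn => ?_⟩, fun i hi => ?_⟩
    · have h2 : l₁ = (List.range l₁.length).map ω := by
        have h3 := List.prefix_iff_eq_take.1 hl₁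
        have h4 : l₁.length ≤ k := by simpa using hl₁.length_le
        rw [← List.map_take, List.take_range, min_eq_left h4] at h3
        exact h3
      have h5 : ∀ h : α → ℝ, (l₁.map h).sum = ∑ i ∈ Finset.range l₁.length, h (ω i) := fun h => by
        conv_lhs => rw [h2, List.map_map]
        rfl
      rw [h5, h5]
      exact hω _ hn
    · have : i < k := by simpa using hi
      simp [this]
  refine (measure_mono hsub).trans ((measure_iUnion_le _).trans
    (ENNReal.tsum_le_tsum fun l => le_of_eq ?_))
  obtain ⟨l, rfl, hl⟩ := l
  rw [hμ, Measure.infinitePi_pi _ fun _ _ => MeasurableSpace.measurableSet_top, Finset.prod_range]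
  change _ = (l.map fun a => ENNReal.ofReal (p a)).prod
  conv_rhs => rw [← List.ofFn_get l, List.map_ofFn, List.prod_ofFn]
  refine Finset.prod_congr rfl fun i _ => ?_
  have : {x | l[(i : ℕ)]? = some x} = {l.get i} := by
    ext x
    simp [eq_comm]
  rw [this, P.toMeasure_apply_singleton _ trivial]
  rfl

end LLN

/-! ### Bridges staying in a narrow cone -/

/-- Reflecting an irreducible bridge across the horizontal axis. -/
def mirrorEquiv : I ≃ I where
  toFun b := ⟨_, b.2.mirror⟩
  invFun b := ⟨_, b.2.mirror⟩
  left_inv _ := Subtype.ext (map_mirror_mirror _)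
  right_inv _ := Subtype.ext (map_mirror_mirror _)

lemma tsum_pr_mul_Y : ∑' b : I, pr b * (Y b.1 : ℝ) = 0 := by
  have h := mirrorEquiv.tsum_eq fun b : I => pr b * (Y b.1 : ℝ)
  have h1 : ∀ b, pr (mirrorEquiv b) * (Y (mirrorEquiv b).1 : ℝ) = -(pr b * (Y b.1 : ℝ)) :=
    fun b => by simp [mirrorEquiv, pr]
  simp_rw [h1, tsum_neg] at h
  linarith

lemma Y_cat (l : List I) : (Y (cat l) : ℝ) = (l.map fun b => (Y b.1 : ℝ)).sum := by
  induction l with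
  | nil => simp
  | cons b l ih => simp [ih]

lemma length_cat (l : List I) :
    ((cat l).length : ℝ) = (l.map fun b => (b.1.length : ℝ)).sum := by
  induction l with
  | nil => simp
  | cons b l ih => simp [ih]

lemma Y_cat_reverse (l : List I) : (Y (cat l.reverse) : ℝ) = Y (cat l) := by
  rw [Y_cat, Y_cat, List.map_reverse, List.sum_reverse]

lemma length_cat_reverse (l : List I) : (cat l.reverse).length = (cat l).length := by
  have : ((cat l.reverse).length : ℝ) = (cat l).length := by
    rw [length_cat, length_cat, List.map_reverse, List.sum_reverse]
  exact_mod_cast this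

lemma ew_cat_reverse (s : ℝ) (l : List I) : ew 0 s (cat l.reverse) = ew 0 s (cat l) := by
  simp [ew, length_cat_reverse]

lemma prefix_cat {u : Walk} {l : List I} (h : u <+: cat l) :
    u = [] ∨ ∃ l₁ b l₂ v, l = l₁ ++ b :: l₂ ∧ v <+: b.1 ∧ u = cat l₁ ++ v := by
  induction l generalizing u with
  | nil => exact Or.inl (by simpa using h)
  | cons b l ih =>
    rcases prefix_append_cases h with h1 | ⟨v, hv, hv0, rfl⟩
    · exact Or.inr ⟨[], b, l, u, rfl, h1, rfl⟩
    · rcases ih hv with h2 | ⟨l₁, c, l₂, v', rfl, h3, rfl⟩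
      · exact absurd h2 hv0
      · exact Or.inr ⟨b :: l₁, c, l₂, v', rfl, h3, by simp⟩

lemma suffix_cat {u : Walk} {l : List I} (h : u <:+ cat l) :
    u = [] ∨ ∃ l₁ b l₂ v, l = l₁ ++ b :: l₂ ∧ v <:+ b.1 ∧ u = v ++ cat l₂ := by
  induction l with
  | nil => exact Or.inl (by simpa using h)
  | cons b l ih =>
    rcases suffix_append_cases h with h1 | ⟨v, hv, hv0, rfl⟩
    · rcases ih h1 with h2 | ⟨l₁, c, l₂, v', rfl, h3, rfl⟩
      · exact Or.inl h2
      · exact Or.inr ⟨b :: l₁, c, l₂, v', rfl, h3, rfl⟩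
    · exact Or.inr ⟨[], b, l, v, rfl, hv, rfl⟩

/-- Uniformly in `k`, a positive proportion of the concatenations of `k` irreducible bridges have
length of order `k` and stay in a shifted cone of slope `ε`. -/
lemma exists_cone_lists (h1 : HasSum pr 1) (h2 : Summable fun b => pr b * b.1.length) :
    ∃ C : ℕ, ∀ ε : ℝ, 0 < ε → ∃ a : ℕ, ∃ c : ℝ≥0∞, 0 < c ∧ ∀ k, a ≤ k →
      c ≤ ∑' l : {l : List I // l.length = k ∧ (cat l).length ≤ C * l.length ∧
        ∀ l₁ b l₂, l = l₁ ++ b :: l₂ →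
          |(Y (cat l₁) : ℝ)| + b.1.length ≤ ε * (a + l₁.length)}, ew 0 sig (cat l.1) := by
  set m : ℝ := ∑' b : I, pr b * (b.1.length : ℝ) with hm
  have hm0 : 0 ≤ m := tsum_nonneg fun b => mul_nonneg (pr_pos b).le (Nat.cast_nonneg _)
  refine ⟨⌈m⌉₊ + 1, fun ε hε => ?_⟩
  have hY : Summable fun b : I => pr b * |(Y b.1 : ℝ)| :=
    h2.of_nonneg_of_le (fun b => mul_nonneg (pr_pos b).le (abs_nonneg _)) fun b =>
      mul_le_mul_of_nonneg_left (by exact_mod_cast abs_Y_le b.1) (pr_pos b).le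
  have hL : Summable fun b : I => pr b * |(b.1.length : ℝ)| := by simpa using h2
  set δ : ℝ := min ε 1 / 4 with hδ
  have hδ0 : 0 < δ := by positivity
  have hδε : 4 * δ ≤ ε := by rw [hδ]; linarith [min_le_left ε 1]
  have hδ1 : 4 * δ ≤ 1 := by rw [hδ]; linarith [min_le_right ε 1]
  obtain ⟨n₀, c, hc, H⟩ := exists_uniform_lln pr (fun b => (pr_pos b).le) h1
    (fun b => (Y b.1 : ℝ)) (fun b => (b.1.length : ℝ)) hY hL hδ0
  obtain ⟨a, ha⟩ := exists_nat_ge (n₀ + (m + 1) * (n₀ + 1) / ε)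
  have ha1 : (m + 1) * (n₀ + 1) ≤ ε * a := by
    have : (m + 1) * (n₀ + 1) / ε ≤ a := by linarith [(Nat.cast_nonneg n₀ : (0 : ℝ) ≤ n₀)]
    rw [div_le_iff₀ hε] at this
    linarith
  have ha0 : n₀ ≤ a := by
    have : (0 : ℝ) ≤ (m + 1) * (n₀ + 1) / ε := by positivity
    exact_mod_cast (by linarith : (n₀ : ℝ) ≤ a)
  refine ⟨a, c, hc, fun k hk => (H k).trans ?_⟩
  refine tsum_le_tsum_of_rel (fun l l' => l.1 = l'.1) (fun ⟨l, hl, hg⟩ => ?_)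
    (fun _ _ _ h h' => Subtype.ext (h.trans h'.symm))
  simp only [tsum_pr_mul_Y, ← hm, ← Y_cat, ← length_cat, zero_mul, sub_zero] at hg
  have hlen : ∀ l₁, l₁ <+: l → n₀ ≤ l₁.length → ((cat l₁).length : ℝ) ≤ (m + δ) * l₁.length :=
    fun l₁ hl₁ hn => by
      have := (abs_le.1 (hg l₁ hl₁ hn).2).2
      linarith
  refine ⟨⟨l, hl, ?_, ?_⟩, rfl, ?_⟩
  · have h3 := hlen l List.prefix_rfl (by omega)
    have h4 : (m + δ) * l.length ≤ (⌈m⌉₊ + 1) * l.length :=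
      mul_le_mul_of_nonneg_right (by linarith [Nat.le_ceil m]) (Nat.cast_nonneg _)
    exact_mod_cast h3.trans h4
  · rintro l₁ b l₂ rfl
    have hp1 : l₁ <+: l₁ ++ b :: l₂ := List.prefix_append _ _
    have hp2 : l₁ ++ [b] <+: l₁ ++ b :: l₂ := ⟨l₂, by simp⟩
    have hl1 : (0 : ℝ) ≤ l₁.length := Nat.cast_nonneg _
    by_cases hn : n₀ ≤ l₁.length
    · have h3 := hg l₁ hp1 hn
      have h4 := hlen _ hp2 (by simp; omega)
      have h5 := (abs_le.1 h3.2).1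
      simp only [cat_append, cat_cons, cat_nil, List.append_nil, List.length_append,
        List.length_cons, List.length_nil, zero_add, Nat.cast_add, Nat.cast_one] at h4
      have h6 : (0 : ℝ) ≤ (m + 1) * n₀ := by positivity
      nlinarith [h3.1]
    · have h3 : ((l₁ ++ b :: l₂).take n₀).length = n₀ := by
        rw [List.length_take, hl]
        omega
      have h4 := hlen _ (List.take_prefix n₀ _) h3.ge
      have h5 : l₁ ++ [b] <+: (l₁ ++ b :: l₂).take n₀ :=
        List.prefix_of_prefix_length_le hp2 (List.take_prefix n₀ _) (by simp [h3]; omega)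
      obtain ⟨t, ht⟩ := h5
      rw [h3, ← ht] at h4
      have h6 : |(Y (cat l₁) : ℝ)| ≤ (cat l₁).length := by exact_mod_cast abs_Y_le (cat l₁)
      simp only [cat_append, cat_cons, cat_nil, List.append_nil, List.length_append,
        Nat.cast_add] at h4
      have h7 : (0 : ℝ) ≤ (cat t).length := Nat.cast_nonneg _
      nlinarith
  · rw [ew_cat]
    simp_rw [ew_sig]
    exact le_rfl

lemma mul_le_wsum_of_blocks {G : List I → Prop} {P : Walk → Prop} {c κ : ℝ≥0∞} {K : ℕ}
    (hG : ∀ k, K ≤ k → c ≤ ∑' l : {l : List I // l.length = k ∧ G l}, ew 0 sig (cat l.1))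
    (F : List I → Walk) (hF : Function.Injective F)
    (hκ : ∀ l, ew 0 sig (F l) = κ * ew 0 sig (cat l))
    (hP : ∀ l, K ≤ l.length → l.length ≤ 2 * K → G l → P (F l)) :
    κ * c * K ≤ wsum P (ew 0 sig) := by
  have h1 : c * K ≤ ∑' k : Fin K,
      ∑' l : {l : List I // l.length = K + k ∧ G l}, ew 0 sig (cat l.1) := by
    calc c * K = ∑' _ : Fin K, c := by simp [mul_comm]
      _ ≤ _ := ENNReal.tsum_le_tsum fun k => hG _ (by omega)
  rw [mul_assoc]
  refine (mul_le_mul_right h1 κ).trans ?_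
  rw [← ENNReal.tsum_sigma, ← ENNReal.tsum_mul_left]
  refine tsum_le_tsum_of_rel (fun x w => w.1 = F x.2.1) (fun x => ?_) (fun x y w hx hy => ?_)
  · obtain ⟨k, l, hl, hg⟩ := x
    exact ⟨⟨F l, hP l (by omega) (by omega) hg⟩, rfl, (hκ l).ge⟩
  · obtain ⟨k, l, hl, hg⟩ := x
    obtain ⟨k', l', hl', hg'⟩ := y
    obtain rfl : l = l' := hF (hx.symm.trans hy)
    obtain rfl : k = k' := Fin.ext (by omega)
    rfl

lemma exists_replicate_append_cat (a : ℕ) : ∃ m : List I, m.length = a ∧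
    cat m = List.replicate a Step.east := by
  refine ⟨List.replicate a ⟨_, irr_east⟩, by simp, ?_⟩
  induction a with
  | zero => simp
  | succ a ih => simp [List.replicate_succ, ih]

lemma X_replicate_east (a : ℕ) : X (List.replicate a Step.east) = a := by
  induction a with
  | zero => simp
  | succ a ih => simp [List.replicate_succ, ih, Step.dx]; ring

lemma Y_replicate_east (a : ℕ) : Y (List.replicate a Step.east) = 0 := by
  induction a with
  | zero => simp
  | succ a ih => simp [List.replicate_succ, ih, Step.dy]

/-- Bridges of width at least `K` and length at most `C * K` staying, as seen from their starting
point, in a cone of slope `ε`. -/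
structure FutureCone (C K : ℕ) (ε : ℝ) (w : Walk) : Prop where
  bridge : Bridge w
  le_X : (K : ℤ) ≤ X w
  length_le : w.length ≤ C * K
  cone : ∀ u, u <+: w → |(Y u : ℝ)| ≤ ε * X u

/-- Bridges of width at least `K` and length at most `C * K` staying, as seen from their endpoint,
in a cone of slope `ε`. -/
structure PastCone (C K : ℕ) (ε : ℝ) (w : Walk) : Prop where
  bridge : Bridge w
  le_X : (K : ℤ) ≤ X w
  length_le : w.length ≤ C * K
  cone : ∀ v, v <:+ w → |(Y v : ℝ)| ≤ ε * X v

lemma exists_mul_le_wsum_cone (h1 : HasSum pr 1) (h2 : Summable fun b => pr b * b.1.length) :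
    ∃ C : ℕ, 0 < C ∧ ∀ ε : ℝ, 0 < ε → ∃ a : ℕ, ∃ c : ℝ≥0∞, 0 < c ∧ ∀ K, a ≤ K →
      c * K ≤ wsum (FutureCone C K ε) (ew 0 sig) ∧ c * K ≤ wsum (PastCone C K ε) (ew 0 sig) := by
  obtain ⟨C, hC⟩ := exists_cone_lists h1 h2
  refine ⟨2 * C + 1, by omega, fun ε hε => ?_⟩
  obtain ⟨a, c, hc, H⟩ := hC ε hε
  obtain ⟨m, hma, hm⟩ := exists_replicate_append_cat a
  set r := List.replicate a Step.east with hr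
  have hr0 : r.length = a := by simp [r]
  have hrY : ∀ u, u <+: r ∨ u <:+ r → ∃ n : ℕ, u = List.replicate n Step.east := fun u hu =>
    ⟨u.length, (List.eq_replicate_of_mem fun b hb => by
      have : b ∈ r := hu.elim (fun h => h.subset hb) fun h => h.subset hb
      exact (List.mem_replicate.1 this).2)⟩
  have hrc : ∀ u, u <+: r ∨ u <:+ r → |(Y u : ℝ)| ≤ ε * X u := fun u hu => by
    obtain ⟨n, rfl⟩ := hrY u hu
    rw [Y_replicate_east, X_replicate_east]
    simp
    positivity
  have hκ : 0 < ew 0 sig r * c := ENNReal.mul_pos (ew_ne_zero _ _ _) hc.ne'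
  have hlen : ∀ (K : ℕ) (l : List I), a ≤ K → l.length ≤ 2 * K →
      (cat l).length ≤ C * l.length → (cat l).length + a ≤ (2 * C + 1) * K := fun K l h3 h4 h5 => by
    have := Nat.mul_le_mul_left C h4
    nlinarith
  have hcone : ∀ (y z : ℤ) (n : ℕ) (x x' : ℤ) (L : ℕ), |(y : ℝ)| + L ≤ ε * (a + n) →
      |(z : ℝ)| ≤ L → (n : ℤ) ≤ x → 0 ≤ x' →
      |((y + z : ℤ) : ℝ)| ≤ ε * ((a + (x + x') : ℤ) : ℝ) := by
    intro y z n x x' L h3 h4 h5 h6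
    have h7 : ε * ((a : ℝ) + n) ≤ ε * ((a + (x + x') : ℤ) : ℝ) := by
      refine mul_le_mul_of_nonneg_left ?_ hε.le
      exact_mod_cast (by omega : (a : ℤ) + n ≤ a + (x + x'))
    push_cast at *
    linarith [abs_add_le (y : ℝ) z]
  refine ⟨a, _, hκ, fun K hK => ⟨?_, ?_⟩⟩
  · refine mul_le_wsum_of_blocks (fun k hk => H k (hK.trans hk)) (fun l => r ++ cat l)
      (fun l l' h => cat_injective (List.append_cancel_left h)) (fun l => ew_append _ _ _ _) ?_
    rintro l hl hl' ⟨h3, h4⟩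
    have hb : Bridge (r ++ cat l) := by
      rw [← hm, ← cat_append]
      exact bridge_cat _
    refine ⟨hb, ?_, ?_, fun u hu => ?_⟩
    · have := length_le_X_cat l
      rw [X_append, hr, X_replicate_east]
      omega
    · have := hlen K l hK hl' h3
      rw [List.length_append, hr0]
      omega
    · rcases prefix_append_cases hu with h5 | ⟨v, hv, hv0, rfl⟩
      · exact hrc u (Or.inl h5)
      · rcases prefix_cat hv with h5 | ⟨l₁, b, l₂, v, rfl, h5, rfl⟩
        · exact absurd h5 hv0
        · have h6 := hcone (Y (cat l₁)) (Y v) l₁.length (X (cat l₁)) (X v) b.1.length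
            (h4 l₁ b l₂ rfl) (by
              have := (abs_Y_le v).trans (by exact_mod_cast h5.length_le :
                (v.length : ℤ) ≤ b.1.length)
              exact_mod_cast this) (length_le_X_cat _) (by
              by_cases hv : v = []
              · simp [hv]
              · exact (b.2.bridge.pos v h5 hv).le)
          simpa [hr, X_replicate_east, Y_replicate_east] using h6
  · refine mul_le_wsum_of_blocks (fun k hk => H k (hK.trans hk)) (fun l => cat l.reverse ++ r)
      (fun l l' h => List.reverse_injective (cat_injective (List.append_cancel_right h)))
      (fun l => by rw [ew_append, ew_cat_reverse, mul_comm]) ?_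
    rintro l hl hl' ⟨h3, h4⟩
    have hb : Bridge (cat l.reverse ++ r) := by
      rw [← hm, ← cat_append]
      exact bridge_cat _
    refine ⟨hb, ?_, ?_, fun u hu => ?_⟩
    · have := length_le_X_cat l.reverse
      rw [List.length_reverse] at this
      rw [X_append, hr, X_replicate_east]
      omega
    · have := hlen K l hK hl' h3
      rw [List.length_append, hr0, length_cat_reverse]
      omega
    · rcases suffix_append_cases hu with h5 | ⟨v, hv, hv0, rfl⟩
      · exact hrc u (Or.inr h5)
      · rcases suffix_cat hv with h5 | ⟨l₁, b, l₂, v, hl, h5, rfl⟩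
        · exact absurd h5 hv0
        · have h6 := hcone (Y (cat l₂)) (Y v) l₂.length (X (cat l₂)) (X v) b.1.length
            (by
              have := h4 l₂.reverse b l₁.reverse (by
                rw [← List.reverse_reverse l, hl]
                simp)
              rwa [Y_cat_reverse, List.length_reverse] at this) (by
              have := (abs_Y_le v).trans (by exact_mod_cast h5.length_le :
                (v.length : ℤ) ≤ b.1.length)
              exact_mod_cast this) (length_le_X_cat _) (b.2.bridge.nonneg v h5)
          simpa [hr, X_replicate_east, Y_replicate_east, add_comm, add_left_comm] using h6

/-! ### Surgery: inserting a rotated bridge -/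

/-- Inserting a rotated bridge contained in a diamond between two bridges contained in cones
produces a bridge. -/
lemma bridge_append_rot_append {a m b : Walk} (ha : Bridge a) (hm : Bridge m) (hb : Bridge b)
    (hm0 : m ≠ []) (ca : ∀ v, v <:+ a → 2 * |Y v| ≤ X v) (cb : ∀ u, u <+: b → 2 * |Y u| ≤ X u)
    (cm : ∀ u, u <+: m → |Y u| ≤ X u) (cm' : ∀ v, v <:+ m → |Y v| ≤ X v)
    (wa : X m < X a) (wb : X m < X b) : Bridge (a ++ m.map Step.rot ++ b) := by
  have hmX := hm.X_pos hm0
  have hmY := abs_le.1 (cm m List.prefix_rfl)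
  have hsuf : ∀ v, v <:+ m → X v ≤ X m := by
    rintro v ⟨u, rfl⟩
    have := (abs_nonneg _).trans (cm u (List.prefix_append _ _))
    simp
    omega
  have hpre : ∀ u, u <+: m → X u ≤ X m := by
    rintro u ⟨v, rfl⟩
    have := (abs_nonneg _).trans (cm' v (List.suffix_append _ _))
    simp
    omega
  refine ⟨(ha.sa.append hm.sa.rot ?_).append hb.sa ?_, fun u hu hn => ?_, fun v hv => ?_⟩
  · rintro u v hu hv - hv0 h
    obtain ⟨v, hv', rfl⟩ := List.prefix_map_iff.1 hv
    have h1 := hm.pos v hv' (by rintro rfl; simp at hv0)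
    have h2 := ca u hu
    have h3 := abs_le.1 (cm v hv')
    have h4 := neg_abs_le (Y u)
    simp at h
    omega
  · rintro u v hu hv - hv0 h
    have h1 := hb.pos v hv hv0
    have h2 := cb v hv
    have h3 := neg_abs_le (Y v)
    rcases suffix_append_cases hu with hu' | ⟨u, hu', -, rfl⟩
    · obtain ⟨u, hu'', rfl⟩ := List.suffix_map_iff.1 hu'
      have h4 := abs_le.1 (cm' u hu'')
      simp at h
      omega
    · have h4 := ca u hu'
      have h5 := neg_abs_le (Y u)
      simp at h
      omega
  · rcases prefix_append_cases hu with hu | ⟨v, hv, hv0, rfl⟩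
    · rcases prefix_append_cases hu with hu | ⟨v, hv, -, rfl⟩
      · exact ha.pos u hu hn
      · obtain ⟨v, hv', rfl⟩ := List.prefix_map_iff.1 hv
        have h1 := abs_le.1 (cm v hv')
        have h2 := hpre v hv'
        simp
        omega
    · have h1 := hb.pos v hv hv0
      simp
      omega
  · rcases suffix_append_cases hv with hv | ⟨u, hu, -, rfl⟩
    · exact hb.nonneg v hv
    · rcases suffix_append_cases hu with hu | ⟨u, hu', -, rfl⟩
      · obtain ⟨u, hu', rfl⟩ := List.suffix_map_iff.1 hu
        have h1 := abs_le.1 (cm' u hu')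
        have h2 := hsuf u hu'
        simp
        omega
      · have h1 := ha.nonneg u hu'
        simp
        omega

lemma FutureCone.two_mul_abs_le {C K : ℕ} {ε : ℝ} {w : Walk} (h : FutureCone C K ε w)
    (hε : ε ≤ 1 / 2) : ∀ u, u <+: w → 2 * |Y u| ≤ X u := fun u hu => by
  have h1 := h.cone u hu
  have h2 : (0 : ℝ) ≤ X u := by
    by_cases hn : u = []
    · simp [hn]
    · exact_mod_cast (h.bridge.pos u hu hn).le
  have h3 : 2 * |(Y u : ℝ)| ≤ X u := by nlinarith
  exact_mod_cast h3

lemma PastCone.two_mul_abs_le {C K : ℕ} {ε : ℝ} {w : Walk} (h : PastCone C K ε w)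
    (hε : ε ≤ 1 / 2) : ∀ v, v <:+ w → 2 * |Y v| ≤ X v := fun v hv => by
  have h1 := h.cone v hv
  have h2 : (0 : ℝ) ≤ X v := by exact_mod_cast h.bridge.nonneg v hv
  have h3 : 2 * |(Y v : ℝ)| ≤ X v := by nlinarith
  exact_mod_cast h3

lemma X_le_of_isPrefix {u w : Walk} (h : Bridge w) (hu : u <+: w) : X u ≤ X w := by
  obtain ⟨v, rfl⟩ := hu
  have := h.nonneg v (List.suffix_append _ _)
  simp
  omega

lemma X_le_of_suffix {v w : Walk} (h : Bridge w) (hv : v <:+ w) : X v ≤ X w := by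
  obtain ⟨u, rfl⟩ := hv
  by_cases hu : u = []
  · simp [hu]
  · have := h.pos u (List.prefix_append _ _) hu
    simp
    omega

/-- A bridge in a future cone followed by a bridge in a past cone lies in a diamond. -/
lemma FutureCone.append_diamond {C K : ℕ} {ε : ℝ} {m₁ m₂ : Walk} (h₁ : FutureCone C K ε m₁)
    (h₂ : PastCone C K ε m₂) (hε : 0 < ε) (hC : ε * (1 + 2 * C) ≤ 1) (hε2 : ε ≤ 1 / 2) :
    (∀ u, u <+: m₁ ++ m₂ → |Y u| ≤ X u) ∧ (∀ v, v <:+ m₁ ++ m₂ → |Y v| ≤ X v) := by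
  have key : ∀ (y y' : ℤ) (x x' z : ℤ), |(y : ℝ)| ≤ ε * x → |(y' : ℝ)| ≤ 2 * ε * x' →
      x' ≤ C * K → K ≤ x → 0 ≤ z → |y + y'| ≤ x + z := by
    intro y y' x x' z h3 h4 h5 h6 h7
    have h5' : (x' : ℝ) ≤ C * K := by exact_mod_cast h5
    have h6' : (K : ℝ) ≤ x := by exact_mod_cast h6
    have h7' : (0 : ℝ) ≤ z := by exact_mod_cast h7
    have h8 : (x' : ℝ) ≤ C * x := h5'.trans (mul_le_mul_of_nonneg_left h6' (Nat.cast_nonneg _))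
    have h9 : (0 : ℝ) ≤ x := (Nat.cast_nonneg K).trans h6'
    have h10 : |((y : ℝ) + y')| ≤ x + z := by
      refine (abs_add_le _ _).trans ?_
      have h11 : 2 * ε * x' ≤ 2 * ε * (C * x) := mul_le_mul_of_nonneg_left h8 (by positivity)
      have h12 : ε * (1 + 2 * C) * x ≤ 1 * x := mul_le_mul_of_nonneg_right hC h9
      linarith
    exact_mod_cast h10
  have hX1 : X m₁ ≤ C * K := (X_le_length m₁).trans (by exact_mod_cast h₁.length_le)
  have hX2 : X m₂ ≤ C * K := (X_le_length m₂).trans (by exact_mod_cast h₂.length_le)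
  refine ⟨fun u hu => ?_, fun v hv => ?_⟩
  · rcases prefix_append_cases hu with hu | ⟨v, hv, hv0, rfl⟩
    · have := h₁.two_mul_abs_le hε2 u hu
      have := abs_nonneg (Y u)
      omega
    · obtain ⟨t, rfl⟩ := hv
      have h3 := h₂.cone _ List.suffix_rfl
      have h4 := h₂.cone t (List.suffix_append _ _)
      have h5 := X_le_of_suffix h₂.bridge (List.suffix_append v t)
      have h6 : |(Y v : ℝ)| ≤ 2 * ε * X (v ++ t) := by
        have h7 : (Y v : ℝ) = Y (v ++ t) - Y t := by simp
        have h8 : ε * X t ≤ ε * X (v ++ t) := by gcongr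
        rw [h7]
        linarith [abs_sub (Y (v ++ t) : ℝ) (Y t : ℝ)]
      rw [Y_append, X_append]
      exact key _ _ _ _ _ (h₁.cone _ List.prefix_rfl) h6 hX2 h₁.le_X
        (h₂.bridge.pos v (List.prefix_append _ _) hv0).le
  · rcases suffix_append_cases hv with hv | ⟨v, hv', hv0, rfl⟩
    · have := h₂.two_mul_abs_le hε2 v hv
      have := abs_nonneg (Y v)
      omega
    · obtain ⟨t, rfl⟩ := hv'
      have h3 := h₁.cone _ List.prefix_rfl
      have h4 := h₁.cone t (List.prefix_append _ _)
      have h5 := X_le_of_isPrefix h₁.bridge (List.prefix_append t v)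
      have h6 : |(Y v : ℝ)| ≤ 2 * ε * X (t ++ v) := by
        have h7 : (Y v : ℝ) = Y (t ++ v) - Y t := by simp
        have h8 : ε * X t ≤ ε * X (t ++ v) := by gcongr
        rw [h7]
        linarith [abs_sub (Y (t ++ v) : ℝ) (Y t : ℝ)]
      rw [Y_append, X_append, add_comm (Y v), add_comm (X v)]
      exact key _ _ _ _ _ (h₂.cone _ List.suffix_rfl) h6 hX1 h₂.le_X
        (h₁.bridge.nonneg v (List.suffix_append _ _))

lemma FutureCone.append_bridge {C K : ℕ} {ε : ℝ} {m₁ m₂ : Walk} (h₁ : FutureCone C K ε m₁)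
    (h₂ : PastCone C K ε m₂) : Bridge (m₁ ++ m₂) := h₁.bridge.append h₂.bridge

lemma injective_mirror : Function.Injective Step.mirror := by
  intro a b h; cases a <;> cases b <;> simp_all [Step.mirror]

/-- Reflect or not, then rotate. -/
def turn (β : Bool) (m : Walk) : Walk :=
  (if β then m else m.map Step.mirror).map Step.rot

@[simp] lemma length_turn (β : Bool) (m : Walk) : (turn β m).length = m.length := by
  cases β <;> simp [turn]

@[simp] lemma ew_turn (s : ℝ) (β : Bool) (m : Walk) : ew 0 s (turn β m) = ew 0 s m := by
  cases β <;> simp [turn, ew]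

lemma turn_injective (β : Bool) : Function.Injective (turn β) := by
  intro m m' h
  have h1 := List.map_injective_iff.2 injective_rot h
  cases β
  · exact List.map_injective_iff.2 injective_mirror h1
  · exact h1

lemma exists_long_irr_turn {C K : ℕ} {ε : ℝ} (hK : 0 < K) (hε : 0 < ε)
    (hC : ε * (1 + 2 * C) ≤ 1) (hε2 : ε ≤ 1 / 2) {a m₁ m₂ b : Walk}
    (ha : PastCone C (3 * C * K) ε a) (h₁ : FutureCone C K ε m₁) (h₂ : PastCone C K ε m₂)
    (hb : FutureCone C (3 * C * K) ε b) :
    ∃ β p c s, a ++ turn β (m₁ ++ m₂) ++ b = p ++ c ++ s ∧ Bridge p ∧ Irr c ∧ Bridge s ∧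
      K ≤ c.length := by
  obtain ⟨d1, d2⟩ := h₁.append_diamond h₂ hε hC hε2
  set m := m₁ ++ m₂ with hm
  have hmb : Bridge m := h₁.append_bridge h₂
  have hKm : K ≤ m.length := by
    have h3 := X_le_length m₁
    have h4 := h₁.le_X
    rw [hm, List.length_append]
    omega
  have hm0 : m ≠ [] := by rintro h; simp [h] at hKm; omega
  have hw : X m < 3 * C * K := by
    have h3 := X_le_length m
    have h4 := h₁.length_le
    have h5 := h₂.length_le
    have h6 : m.length ≤ 2 * (C * K) := by rw [hm, List.length_append]; omega
    have h7 : 0 < C * K := by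
      have : 0 < m.length := List.length_pos_iff.2 hm0
      omega
    have h8 : ((m.length : ℕ) : ℤ) < 3 * (C * K : ℕ) := by omega
    push_cast at h8
    linarith
  have hwa := ha.le_X
  have hwb := hb.le_X
  push_cast at hwa hwb
  obtain ⟨β, hβ, hX⟩ : ∃ β, Bridge (a ++ turn β m ++ b) ∧ X (turn β m) ≤ 0 := by
    rcases le_total 0 (Y m) with h | h
    · refine ⟨true, bridge_append_rot_append ha.bridge hmb hb.bridge hm0 (ha.two_mul_abs_le hε2)
        (hb.two_mul_abs_le hε2) d1 d2 ?_ ?_, by simpa [turn] using h⟩ <;> simp only [if_true] <;>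
        omega
    · refine ⟨false, bridge_append_rot_append ha.bridge hmb.mirror hb.bridge (by simpa using hm0)
        (ha.two_mul_abs_le hε2) (hb.two_mul_abs_le hε2) ?_ ?_ (by simp; omega) (by simp; omega),
        by simpa [turn, -List.map_map] using h⟩
      · intro u hu
        obtain ⟨v, hv, rfl⟩ := List.prefix_map_iff.1 hu
        simpa using d1 v hv
      · intro u hu
        obtain ⟨v, hv, rfl⟩ := List.suffix_map_iff.1 hu
        simpa using d2 v hv
  obtain ⟨p, c, s, h3, h4, h5, h6, h7⟩ := exists_long_irr hβ rfl hX
    (by rw [← List.length_pos_iff, length_turn, List.length_pos_iff]; exact hm0)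
  rw [length_turn] at h7
  exact ⟨β, p, c, s, h3, h4, h5, h6, hKm.trans h7⟩

lemma tsum_mul_tsum {α β : Type*} (f : α → ℝ≥0∞) (g : β → ℝ≥0∞) :
    (∑' a, f a) * ∑' b, g b = ∑' x : α × β, f x.1 * g x.2 := by
  simp_rw [ENNReal.tsum_prod', ENNReal.tsum_mul_left, ENNReal.tsum_mul_right]

lemma wsum_cone_mul_le (hq : q 0 sig = 1) {C K : ℕ} {ε : ℝ} (hK : 0 < K) (hC0 : 0 < C)
    (hε : 0 < ε) (hC : ε * (1 + 2 * C) ≤ 1) (hε2 : ε ≤ 1 / 2) :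
    wsum (PastCone C (3 * C * K) ε) (ew 0 sig) * wsum (FutureCone C K ε) (ew 0 sig) *
      (wsum (PastCone C K ε) (ew 0 sig) * wsum (FutureCone C (3 * C * K) ε) (ew 0 sig)) ≤
    2 * (9 * C ^ 2 * K : ℕ) ^ 5 * wsum (fun w => Irr w ∧ K ≤ w.length) (ew 0 sig) := by
  set N : ℕ := 6 * C ^ 2 * K + 2 * C * K with hN
  have hN1 : N + 1 ≤ 9 * C ^ 2 * K := by
    have h1 : C * 1 * K ≤ C * C * K := by gcongr; omega
    have h2 : 1 ≤ C * C * K := Nat.mul_pos (Nat.mul_pos hC0 hC0) hK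
    rw [hN]
    nlinarith
  have e : wsum (fun w => Bridge w ∧ X w ≤ N) (ew 0 sig) *
      wsum (fun w => Irr w ∧ K ≤ w.length) (ew 0 sig) *
      wsum (fun w => Bridge w ∧ X w ≤ N) (ew 0 sig) *
      ∑' _ : Fin (N + 1) × Fin (N + 1) × Fin (N + 1) × Bool, 1 ≤
      2 * (9 * C ^ 2 * K : ℕ) ^ 5 * wsum (fun w => Irr w ∧ K ≤ w.length) (ew 0 sig) := by
    have h1 := wsum_bridge_X_le sig hq.le N
    have h2 : ((N : ℝ≥0∞) + 1) ≤ (9 * C ^ 2 * K : ℕ) := by exact_mod_cast hN1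
    have h3 : ∑' _ : Fin (N + 1) × Fin (N + 1) × Fin (N + 1) × Bool, (1 : ℝ≥0∞) =
        2 * ((N : ℝ≥0∞) + 1) ^ 3 := by
      rw [tsum_fintype]
      simp
      ring
    rw [h3]
    calc _ ≤ ((N : ℝ≥0∞) + 1) * wsum (fun w => Irr w ∧ K ≤ w.length) (ew 0 sig) * (N + 1) *
          (2 * ((N : ℝ≥0∞) + 1) ^ 3) := by gcongr
      _ = 2 * ((N : ℝ≥0∞) + 1) ^ 5 * wsum (fun w => Irr w ∧ K ≤ w.length) (ew 0 sig) := by ring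
      _ ≤ _ := by gcongr
  refine le_trans ?_ e
  simp_rw [wsum, tsum_mul_tsum]
  refine tsum_le_tsum_of_rel (fun x y =>
    x.1.1.1 ++ turn y.2.2.2.2 (x.1.2.1 ++ x.2.1.1) ++ x.2.2.1 =
      y.1.1.1.1 ++ y.1.1.2.1 ++ y.1.2.1 ∧
    x.1.1.1.length = y.2.1 ∧ x.1.2.1.length = y.2.2.1 ∧ x.2.1.1.length = y.2.2.2.1) ?_ ?_
  · rintro ⟨⟨⟨a, ha⟩, m₁, h₁⟩, ⟨m₂, h₂⟩, b, hb⟩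
    obtain ⟨β, p, c, s, h3, h4, h5, h6, h7⟩ := exists_long_irr_turn hK hε hC hε2 ha h₁ h₂ hb
    have hl := congrArg List.length h3
    simp only [List.length_append, length_turn] at hl
    have l1 := ha.length_le
    have l2 := hb.length_le
    have l3 := h₁.length_le
    have l4 := h₂.length_le
    have l5 : C * (3 * C * K) = 3 * C ^ 2 * K := by ring
    have l6 : N = 2 * (3 * C ^ 2 * K) + 2 * (C * K) := by rw [hN]; ring
    rw [l5] at l1 l2
    have hp : X p ≤ N := (X_le_length p).trans (by exact_mod_cast (by omega : p.length ≤ N))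
    have hs : X s ≤ N := (X_le_length s).trans (by exact_mod_cast (by omega : s.length ≤ N))
    refine ⟨(((⟨p, h4, hp⟩, ⟨c, h5, h7⟩), ⟨s, h6, hs⟩), ⟨a.length, by omega⟩,
      ⟨m₁.length, by omega⟩, ⟨m₂.length, by omega⟩, β), ⟨h3, rfl, rfl, rfl⟩, le_of_eq ?_⟩
    have hw := congrArg (ew 0 sig) h3
    simp only [ew_append, ew_turn] at hw
    simp only [mul_one]
    rw [← hw]
    ring
  · rintro ⟨⟨⟨a, ha⟩, m₁, h₁⟩, ⟨m₂, h₂⟩, b, hb⟩ ⟨⟨⟨a', ha'⟩, m₁', h₁'⟩, ⟨m₂', h₂'⟩, b', hb'⟩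
      ⟨_, i, j, k, β⟩ ⟨h, hi, hj, hk⟩ ⟨h', hi', hj', hk'⟩
    simp only at h h' hi hi' hj hj' hk hk'
    have h3 := h.trans h'.symm
    obtain ⟨h4, rfl⟩ := List.append_inj h3 (by simp; omega)
    obtain ⟨rfl, h5⟩ := List.append_inj h4 (by omega)
    obtain ⟨rfl, rfl⟩ := List.append_inj (turn_injective β h5) (by omega)
    rfl

/-- If the irreducible bridges carry a critical renewal measure, then it has infinite mean. -/
theorem not_summable_pr_mul (hq : q 0 sig = 1) : ¬ Summable fun b => pr b * b.1.length := by
  intro h2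
  obtain ⟨C, hC0, hC⟩ := exists_mul_le_wsum_cone (hasSum_pr hq) h2
  set ε : ℝ := 1 / (2 * (1 + 2 * C)) with hε
  have hε0 : 0 < ε := by positivity
  have hεC : ε * (1 + 2 * C) ≤ 1 := by
    rw [hε, div_mul_eq_mul_div, div_le_one (by positivity)]
    linarith [(Nat.cast_nonneg C : (0 : ℝ) ≤ C)]
  have hε2 : ε ≤ 1 / 2 := by
    rw [hε]
    exact one_div_le_one_div_of_le (by norm_num) (by linarith [(Nat.cast_nonneg C : (0 : ℝ) ≤ C)])
  obtain ⟨a, c, hc, H⟩ := hC ε hε0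
  set A : ℝ≥0∞ := 2 * (9 * C ^ 2 : ℕ) ^ 5 with hA
  have hA1 : A ≠ ⊤ := by
    rw [hA]
    exact ENNReal.mul_ne_top (by simp) (ENNReal.pow_ne_top (ENNReal.natCast_ne_top _))
  have hc4 : c ^ 4 ≠ 0 := pow_ne_zero _ hc.ne'
  obtain ⟨η, hη, hηA⟩ := ENNReal.exists_nnreal_pos_mul_lt hA1 hc4
  have htail : wsum Irr (fun w => w.length * ew 0 sig w) ≠ ⊤ := by
    have h3 : wsum Irr (fun w => w.length * ew 0 sig w) =
        ∑' b : I, ENNReal.ofReal (pr b * b.1.length) := tsum_congr fun b => by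
      change (b.1.length : ℝ≥0∞) * ew 0 sig b.1 = _
      rw [ew_sig, mul_comm, ENNReal.ofReal_mul (pr_pos b).le, ENNReal.ofReal_natCast]
    rw [h3, ← ENNReal.ofReal_tsum_of_nonneg (fun b => by have := pr_pos b; positivity) h2]
    exact ENNReal.ofReal_ne_top
  obtain ⟨n, hn⟩ := exists_tail_le htail List.length (ε := η) (by exact_mod_cast hη)
  set K := max (max a n) 1 with hK
  have hK1 : 0 < K := by omega
  have h3K : K ≤ 3 * C * K := Nat.le_mul_of_pos_left _ (by omega)
  have h3 := wsum_cone_mul_le hq hK1 hC0 hε0 hεC hε2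
  have h4 := H K (by omega)
  have h5 := H (3 * C * K) (by omega)
  have h6 : (K : ℝ≥0∞) * wsum (fun w => Irr w ∧ K ≤ w.length) (ew 0 sig) ≤ η := by
    rw [← wsum_mul_left]
    refine (wsum_mono fun w hw => ⟨⟨hw.1, by omega⟩, ?_⟩).trans hn
    have : (K : ℝ≥0∞) ≤ w.length := by exact_mod_cast hw.2
    gcongr
  have h7 : c ^ 4 * (K : ℝ≥0∞) ^ 4 ≤ η * A * (K : ℝ≥0∞) ^ 4 := by
    have h8 : (K : ℝ≥0∞) ≤ (3 * C * K : ℕ) := by exact_mod_cast h3K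
    calc c ^ 4 * (K : ℝ≥0∞) ^ 4 = c * K * (c * K) * (c * K * (c * K)) := by ring
      _ ≤ c * (3 * C * K : ℕ) * (c * K) * (c * K * (c * (3 * C * K : ℕ))) := by gcongr
      _ ≤ _ := by
        gcongr
        exacts [h5.2, h4.1, h4.2, h5.1]
      _ ≤ _ := h3
      _ = A * (K : ℝ≥0∞) ^ 4 *
          (K * wsum (fun w => Irr w ∧ K ≤ w.length) (ew 0 sig)) := by
        rw [hA]; push_cast; ring
      _ ≤ A * (K : ℝ≥0∞) ^ 4 * η := by gcongr
      _ = _ := by ring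
  have h8 : (K : ℝ≥0∞) ^ 4 ≠ 0 := pow_ne_zero _ (by exact_mod_cast hK1.ne')
  have h9 : (K : ℝ≥0∞) ^ 4 ≠ ⊤ := ENNReal.pow_ne_top (ENNReal.natCast_ne_top _)
  exact absurd ((ENNReal.mul_le_mul_iff_left h8 h9).1 h7) (not_le.2 hηA)

/-- All positive speeds are bad. -/
theorem bad_of_pos {v : ℝ} (hv : 0 < v) : Bad v := by
  by_contra h
  obtain ⟨C, hC⟩ := one_sub_q_le hv h
  exact not_summable_pr_mul (q_sig hC) (summable_pr_mul hC)

/-! ### The endpoint of a uniform self-avoiding walk -/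

/-- The number of self-avoiding walks of length `n` satisfying `P`. -/
noncomputable def cntOf (P : Walk → Prop) (n : ℕ) : ℕ :=
  {w : Walk | (SelfAvoiding w ∧ w.length = n) ∧ P w}.ncard

lemma finite_saw_and (P : Walk → Prop) (n : ℕ) :
    {w : Walk | (SelfAvoiding w ∧ w.length = n) ∧ P w}.Finite :=
  (finite_saw n).subset fun _ h => h.1

lemma tendsto_cntOf_X {η : ℝ} (hη : 0 < η) :
    Tendsto (fun n : ℕ => (cntOf (fun w => η * w.length ≤ X w) n : ℝ) / cnt n) atTop (𝓝 0) := by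
  obtain ⟨lam, hl, h1⟩ := (bad_of_pos (v := η / 3) (by positivity)).wsum_ne_top
    (by positivity) (δ := η / 3) (by positivity)
  have h2 := wsum_selfAvoiding_tilt_ne_top hl.le h1
  set S := wsum SelfAvoiding (ew lam (sig + lam * (η / 3 + η / 3))) with hS
  have key : ∀ n : ℕ, (cntOf (fun w => η * w.length ≤ X w) n : ℝ) / cnt n ≤
      S.toReal * Real.exp (-(lam * (η / 3))) ^ n := by
    intro n
    have hf := finite_saw_and (fun w => η * w.length ≤ X w) n
    set c := cntOf (fun w => η * w.length ≤ X w) n with hc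
    have h3 : (c : ℝ≥0∞) * ENNReal.ofReal (Real.exp (-sig * n + lam * (η / 3) * n)) ≤ S := by
      have h4 : wsum (fun w => (SelfAvoiding w ∧ w.length = n) ∧ η * w.length ≤ X w)
          (fun _ => ENNReal.ofReal (Real.exp (-sig * n + lam * (η / 3) * n))) ≤ S := by
        refine wsum_mono fun w hw => ⟨hw.1.1, ENNReal.ofReal_le_ofReal (Real.exp_le_exp.2 ?_)⟩
        obtain ⟨⟨-, h5⟩, h6⟩ := hw
        rw [h5] at h6 ⊢
        have := mul_le_mul_of_nonneg_left h6 hl.le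
        linarith
      have : Fintype {w : Walk // (SelfAvoiding w ∧ w.length = n) ∧ η * w.length ≤ X w} :=
        hf.fintype
      rw [wsum, tsum_fintype, Finset.sum_const, nsmul_eq_mul, Finset.card_univ,
        ← Nat.card_eq_fintype_card] at h4
      exact h4
    have h4 := ENNReal.toReal_mono h2 h3
    rw [ENNReal.toReal_mul, ENNReal.toReal_natCast, ENNReal.toReal_ofReal (Real.exp_pos _).le] at h4
    have hn : (0 : ℝ) < cnt n := by exact_mod_cast cnt_pos n
    rw [div_le_iff₀ hn]
    have h5 : (c : ℝ) = c * Real.exp (-sig * n + lam * (η / 3) * n) *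
        (Real.exp (-(lam * (η / 3))) ^ n * Real.exp (sig * n)) := by
      rw [← Real.exp_nat_mul, mul_assoc, ← Real.exp_add, ← Real.exp_add]
      ring_nf
      simp
    have h6 : 0 ≤ S.toReal := ENNReal.toReal_nonneg
    calc (c : ℝ) = _ := h5
      _ ≤ S.toReal * (Real.exp (-(lam * (η / 3))) ^ n * cnt n) := by
        gcongr
        exact exp_sig_le_cnt n
      _ = _ := by ring
  have h3 : Tendsto (fun n : ℕ => S.toReal * Real.exp (-(lam * (η / 3))) ^ n) atTop (𝓝 0) := by
    have hpos : 0 < lam * (η / 3) := by positivity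
    have := tendsto_pow_atTop_nhds_zero_of_lt_one (Real.exp_pos (-(lam * (η / 3)))).le
      (Real.exp_lt_one_iff.2 (by linarith))
    simpa using this.const_mul S.toReal
  exact squeeze_zero (fun n => by positivity) key h3

lemma cntOf_le_of_map {P Q : Walk → Prop} (f : Step → Step) (hf : Function.Injective f)
    (hs : ∀ w, SelfAvoiding w → SelfAvoiding (w.map f)) (h : ∀ w, P w → Q (w.map f)) (n : ℕ) :
    cntOf P n ≤ cntOf Q n :=
  Set.ncard_le_ncard_of_injOn (List.map f)
    (fun w hw => ⟨⟨hs w hw.1.1, by simpa using hw.1.2⟩, h w hw.2⟩)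
    (List.map_injective_iff.2 hf).injOn (finite_saw_and Q n)

lemma cntOf_or_le (P Q : Walk → Prop) (n : ℕ) :
    cntOf (fun w => P w ∨ Q w) n ≤ cntOf P n + cntOf Q n := by
  refine (Set.ncard_le_ncard (fun w hw => ?_)
    ((finite_saw_and P n).union (finite_saw_and Q n))).trans (Set.ncard_union_le _ _)
  exact hw.2.imp (fun h => ⟨hw.1, h⟩) fun h => ⟨hw.1, h⟩

lemma tendsto_cntOf_max {η : ℝ} (hη : 0 < η) :
    Tendsto (fun n : ℕ => (cntOf (fun w => (η * w.length ≤ X w ∨ η * w.length ≤ -X w) ∨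
      (η * w.length ≤ Y w ∨ η * w.length ≤ -Y w)) n : ℝ) / cnt n) atTop (𝓝 0) := by
  have h := (tendsto_cntOf_X hη).const_mul 4
  rw [mul_zero] at h
  refine squeeze_zero (fun n => by positivity) (fun n => ?_) h
  rw [← mul_div_assoc]
  gcongr
  have h1 := cntOf_le_of_map (P := fun w => η * w.length ≤ -X w)
    (Q := fun w => η * w.length ≤ X w) Step.flip injective_flip (fun _ => .flip)
    (fun w hw => by simpa using hw) n
  have h2 := cntOf_le_of_map (P := fun w => η * w.length ≤ Y w)
    (Q := fun w => η * w.length ≤ X w) Step.unrot injective_unrot (fun _ => .unrot)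
    (fun w hw => by simpa using hw) n
  have h3 := cntOf_le_of_map (P := fun w => η * w.length ≤ -Y w)
    (Q := fun w => η * w.length ≤ X w) Step.rot injective_rot (fun _ => .rot)
    (fun w hw => by simpa using hw) n
  have h4 := cntOf_or_le (fun w => η * w.length ≤ X w ∨ η * w.length ≤ -X w)
    (fun w => η * w.length ≤ Y w ∨ η * w.length ≤ -Y w) n
  have h5 := cntOf_or_le (fun w => η * w.length ≤ X w) (fun w => η * w.length ≤ -X w) n
  have h6 := cntOf_or_le (fun w => η * w.length ≤ Y w) (fun w => η * w.length ≤ -Y w) n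
  have h7 : cntOf (fun w => (η * w.length ≤ X w ∨ η * w.length ≤ -X w) ∨
      (η * w.length ≤ Y w ∨ η * w.length ≤ -Y w)) n ≤
      4 * cntOf (fun w => η * w.length ≤ X w) n := by omega
  exact_mod_cast h7

/-- Euclidean distance between the endpoints of a walk. -/
noncomputable def dist₂ (w : Walk) : ℝ := Real.sqrt ((X w : ℝ) ^ 2 + (Y w : ℝ) ^ 2)

lemma dist₂_nonneg (w : Walk) : 0 ≤ dist₂ w := Real.sqrt_nonneg _

lemma dist₂_le {w : Walk} {r : ℝ} (hx : |(X w : ℝ)| ≤ r) (hy : |(Y w : ℝ)| ≤ r) :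
    dist₂ w ≤ 2 * r := by
  have hr : 0 ≤ r := (abs_nonneg _).trans hx
  refine Real.sqrt_le_iff.2 ⟨by positivity, ?_⟩
  have h1 := sq_le_sq' (abs_le.1 hx).1 (abs_le.1 hx).2
  have h2 := sq_le_sq' (abs_le.1 hy).1 (abs_le.1 hy).2
  nlinarith

lemma tendsto_sum_dist₂ {p : ℝ} (hp : 1 ≤ p) :
    Tendsto (fun n : ℕ => (∑ w ∈ (finite_saw n).toFinset, dist₂ w ^ p) / cnt n / (n : ℝ) ^ p)
      atTop (𝓝 0) := by
  have hp0 : 0 ≤ p := by linarith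
  have hnn : ∀ n : ℕ,
      0 ≤ (∑ w ∈ (finite_saw n).toFinset, dist₂ w ^ p) / cnt n / (n : ℝ) ^ p := fun n => by
    have : 0 ≤ ∑ w ∈ (finite_saw n).toFinset, dist₂ w ^ p :=
      Finset.sum_nonneg fun w _ => Real.rpow_nonneg (dist₂_nonneg w) p
    positivity
  refine tendsto_order.2 ⟨fun a ha => Eventually.of_forall fun n => ha.trans_le (hnn n),
    fun ε hε => ?_⟩
  set η : ℝ := min (ε / 4) (1 / 2) with hηdef
  have hη : 0 < η := by positivity
  have hη1 : 2 * η ≤ 1 := by linarith [min_le_right (ε / 4) (1 / 2)]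
  have hη2 : (2 * η) ^ p ≤ ε / 2 := by
    have h1 : (2 * η) ^ p ≤ (2 * η) ^ (1 : ℝ) :=
      Real.rpow_le_rpow_of_exponent_ge (by positivity) hη1 hp
    rw [Real.rpow_one] at h1
    linarith [min_le_left (ε / 4) (1 / 2)]
  have hlim := (tendsto_cntOf_max hη).const_mul ((2 : ℝ) ^ p)
  rw [mul_zero] at hlim
  filter_upwards [(tendsto_order.1 hlim).2 (ε / 2) (by positivity), eventually_gt_atTop 0]
    with n hn hn0
  set F : Walk → Prop := fun w => (η * w.length ≤ X w ∨ η * w.length ≤ -X w) ∨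
      (η * w.length ≤ Y w ∨ η * w.length ≤ -Y w) with hF
  have hn1 : (0 : ℝ) < n := by exact_mod_cast hn0
  have hc : (0 : ℝ) < cnt n := by exact_mod_cast cnt_pos n
  have hsum : ∑ w ∈ (finite_saw n).toFinset, dist₂ w ^ p ≤
      (cnt n : ℝ) * (2 * η * n) ^ p + (cntOf F n : ℝ) * (2 * n) ^ p := by
    have h1 : ∀ w ∈ (finite_saw n).toFinset,
        dist₂ w ^ p ≤ (2 * η * n) ^ p + if F w then (2 * (n : ℝ)) ^ p else 0 := by
      intro w hw
      obtain ⟨-, hw⟩ := (finite_saw n).mem_toFinset.1 hw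
      split_ifs with h
      · have h2 : dist₂ w ≤ 2 * n := by
          refine dist₂_le ?_ ?_
          · rw [← hw]; exact_mod_cast abs_X_le w
          · rw [← hw]; exact_mod_cast abs_Y_le w
        have h3 := Real.rpow_le_rpow (dist₂_nonneg w) h2 hp0
        have h4 : (0 : ℝ) ≤ (2 * η * n) ^ p := by positivity
        linarith
      · simp only [hF, hw] at h
        push Not at h
        rw [add_zero, mul_assoc]
        refine Real.rpow_le_rpow (dist₂_nonneg w) (dist₂_le ?_ ?_) hp0
        · exact abs_le.2 ⟨by linarith [h.1.2], h.1.1.le⟩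
        · exact abs_le.2 ⟨by linarith [h.2.2], h.2.1.le⟩
    refine (Finset.sum_le_sum h1).trans (le_of_eq ?_)
    rw [Finset.sum_add_distrib, Finset.sum_const, ← Finset.sum_filter, Finset.sum_const,
      nsmul_eq_mul, nsmul_eq_mul, cnt, cntOf, Set.ncard_eq_toFinset_card _ (finite_saw n),
      Set.ncard_eq_toFinset_card _ (finite_saw_and F n)]
    congr 4
    ext w
    simp
  have hnp : (0 : ℝ) < (n : ℝ) ^ p := by positivity
  rw [div_div, div_lt_iff₀ (by positivity)]
  refine hsum.trans_lt ?_
  rw [Real.mul_rpow (by positivity) hn1.le, Real.mul_rpow (by positivity) hn1.le]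
  have h2 : (cntOf F n : ℝ) * 2 ^ p < ε / 2 * cnt n := by
    rw [← mul_div_assoc, div_lt_iff₀ hc] at hn
    linarith
  have h3 : (cnt n : ℝ) * (2 * η) ^ p ≤ cnt n * (ε / 2) := by gcongr
  nlinarith

/-! ### Self-avoiding walks as functions -/

/-- The vertices visited by a walk of length `n`. -/
def path (n : ℕ) (w : Walk) : Fin (n + 1) → ℤ × ℤ :=
  fun i => (X (w.take i), Y (w.take i))

lemma path_last {n : ℕ} {w : Walk} (hw : w.length = n) : path n w (Fin.last n) = (X w, Y w) := by
  simp [path, ← hw]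

lemma path_injective {n : ℕ} {w w' : Walk} (hw : w.length = n) (hw' : w'.length = n)
    (h : path n w = path n w') : w = w' := by
  refine List.ext_getElem (hw.trans hw'.symm) fun i h1 h2 => ?_
  have e1 := congrFun h ⟨i, by omega⟩
  have e2 := congrFun h ⟨i + 1, by omega⟩
  simp only [path, ← List.take_concat_get' _ _ h1, ← List.take_concat_get' _ _ h2, X_append,
    Y_append, X_cons, Y_cons, X_nil, Y_nil, add_zero, Prod.mk.injEq] at e1 e2
  have h3 : (w[i]).dx = (w'[i]).dx := by omega
  have h4 : (w[i]).dy = (w'[i]).dy := by omega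
  revert h3 h4
  cases w[i] <;> cases w'[i] <;> simp [Step.dx, Step.dy]

lemma exists_step {x y : ℤ} (h : |x| + |y| = 1) : ∃ a : Step, a.dx = x ∧ a.dy = y := by
  have h1 : (x = 1 ∧ y = 0) ∨ (x = -1 ∧ y = 0) ∨ (x = 0 ∧ y = 1) ∨ (x = 0 ∧ y = -1) := by
    grind
  rcases h1 with ⟨rfl, rfl⟩ | ⟨rfl, rfl⟩ | ⟨rfl, rfl⟩ | ⟨rfl, rfl⟩
  exacts [⟨.east, rfl, rfl⟩, ⟨.west, rfl, rfl⟩, ⟨.north, rfl, rfl⟩, ⟨.south, rfl, rfl⟩]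

lemma exists_path_eq {n : ℕ} {h : Fin (n + 1) → ℤ × ℤ} (h0 : h 0 = (0, 0))
    (h1 : ∀ i : Fin n,
      |(h i.succ).1 - (h i.castSucc).1| + |(h i.succ).2 - (h i.castSucc).2| = 1) :
    ∃ w : Walk, w.length = n ∧ path n w = h := by
  have key : ∀ k ≤ n, ∃ w : Walk, w.length = k ∧
      ∀ i : Fin (n + 1), (i : ℕ) ≤ k → path n w i = h i := by
    intro k
    induction k with
    | zero =>
      refine fun _ => ⟨[], rfl, fun i hi => ?_⟩
      obtain rfl : i = 0 := Fin.ext (by simpa using hi)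
      simp [path, h0]
    | succ k ih =>
      intro hk
      obtain ⟨w, hw, hp⟩ := ih (by omega)
      obtain ⟨a, ha, hb⟩ := exists_step (h1 ⟨k, hk⟩)
      refine ⟨w ++ [a], by simp [hw], fun i hi => ?_⟩
      rcases Nat.lt_or_ge k i with h2 | h2
      · obtain rfl : i = Fin.succ ⟨k, hk⟩ := Fin.ext (by simp; omega)
        have h3 := hp (Fin.castSucc ⟨k, hk⟩) (by simp)
        simp only [path, Fin.val_castSucc, List.take_of_length_le hw.le] at h3
        simp only [path, Fin.val_succ]
        rw [List.take_of_length_le (by simp [hw])]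
        ext
        · simp only [X_append, X_cons, X_nil, ha, ← h3]
          ring
        · simp only [Y_append, Y_cons, Y_nil, hb, ← h3]
          ring
      · rw [← hp i h2, path, path, List.take_append_of_le_length (by omega)]
  obtain ⟨w, hw, hp⟩ := key n le_rfl
  exact ⟨w, hw, funext fun i => hp i (by omega)⟩

lemma path_mem_SAW_iff {n : ℕ} {w : Walk} (hw : w.length = n) :
    path n w ∈ SAW n ↔ SelfAvoiding w := by
  have hdiff : ∀ i j : ℕ, i ≤ j → ∃ u, u <:+: w ∧ w.take j = w.take i ++ u ∧
      u.length = (w.take j).length - (w.take i).length := by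
    intro i j hij
    obtain ⟨u, hu⟩ := List.take_prefix_take_left (l := w) hij
    refine ⟨u, ?_, hu.symm, by rw [← hu, List.length_append]; omega⟩
    exact List.IsInfix.trans ⟨w.take i, [], by simpa using hu⟩ (List.take_prefix j w).isInfix
  rw [SAW, Finset.mem_filter]
  constructor
  · rintro ⟨-, -, -, hinj⟩ u ⟨a, b, hab⟩ hu ⟨hX, hY⟩
    have hl := congrArg List.length hab
    simp only [List.length_append] at hl
    have h1 : path n w ⟨a.length, by omega⟩ = path n w ⟨a.length + u.length, by omega⟩ := by
      have e1 : w.take a.length = a := by rw [← hab]; simp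
      have e2 : w.take (a.length + u.length) = a ++ u := by
        rw [← hab, ← List.length_append, List.take_left']
        rfl
      simp [path, e1, e2, hX, hY]
    have h2 := congrArg Fin.val (hinj h1)
    simp only at h2
    exact hu (List.length_eq_zero_iff.1 (by omega))
  · intro hs
    refine ⟨?_, by simp [path], fun i => ?_, ?_⟩
    · rw [walkBox, Fintype.mem_piFinset]
      intro i
      have h1 : ((w.take i).length : ℤ) ≤ n := by
        rw [List.length_take]
        omega
      have h2 := abs_le.1 ((abs_X_le (w.take i)).trans h1)
      have h3 := abs_le.1 ((abs_Y_le (w.take i)).trans h1)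
      simp only [path, Finset.mem_product, Finset.mem_Icc]
      exact ⟨h2, h3⟩
    · have hi : (i : ℕ) < w.length := by omega
      simp only [path, Fin.val_succ, Fin.val_castSucc, ← List.take_concat_get' _ _ hi, X_append,
        Y_append, X_cons, Y_cons, X_nil, Y_nil, add_zero, add_sub_cancel_left]
      cases w[(i : ℕ)] <;> simp [Step.dx, Step.dy]
    · have key : ∀ i j : Fin (n + 1), i < j → path n w i ≠ path n w j := by
        intro i j hij he
        obtain ⟨u, hu, h1, h2⟩ := hdiff i j hij.le
        simp only [path, h1, X_append, Y_append, Prod.mk.injEq] at he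
        refine hs u hu ?_ ⟨by omega, by omega⟩
        rw [← List.length_pos_iff, h2, List.length_take, List.length_take]
        have := j.isLt
        have : (i : ℕ) < j := hij
        omega
      intro i j he
      rcases lt_trichotomy i j with h | h | h
      · exact absurd he (key i j h)
      · exact h
      · exact absurd he.symm (key j i h)

lemma SAW_eq_image (n : ℕ) : SAW n = (finite_saw n).toFinset.image (path n) := by
  ext h
  rw [Finset.mem_image]
  constructor
  · intro hh
    obtain ⟨w, hw, rfl⟩ := exists_path_eq (Finset.mem_filter.1 hh).2.1
      (Finset.mem_filter.1 hh).2.2.1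
    exact ⟨w, (finite_saw n).mem_toFinset.2 ⟨(path_mem_SAW_iff hw).1 hh, hw⟩, rfl⟩
  · rintro ⟨w, hw, rfl⟩
    obtain ⟨h1, h2⟩ := (finite_saw n).mem_toFinset.1 hw
    exact (path_mem_SAW_iff h2).2 h1

lemma meanEndNorm_eq (n : ℕ) (p : ℝ) :
    meanEndNorm n p = (∑ w ∈ (finite_saw n).toFinset, dist₂ w ^ p) / cnt n := by
  have hinj : Set.InjOn (path n) (finite_saw n).toFinset := fun w hw w' hw' h =>
    path_injective ((finite_saw n).mem_toFinset.1 hw).2 ((finite_saw n).mem_toFinset.1 hw').2 h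
  rw [meanEndNorm, SAW_eq_image, Finset.sum_image hinj, Finset.card_image_of_injOn hinj, cnt,
    Set.ncard_eq_toFinset_card _ (finite_saw n)]
  congr 1
  refine Finset.sum_congr rfl fun w hw => ?_
  rw [endNorm, path_last ((finite_saw n).mem_toFinset.1 hw).2, dist₂]

end SAWalk

/-- Duminil-Copin–Hammond: the self-avoiding walk is sub-ballistic in
mean.  For the uniform measure on `N`-step self-avoiding walks in `ℤ²` and every `p ≥ 1`,
`N⁻¹ (E_N[‖h(N)‖^p])^{1/p} → 0` as `N → ∞`. -/
theorem saw_sublinear (p : ℝ) (hp : 1 ≤ p) :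
    Tendsto (fun N : ℕ => (N : ℝ)⁻¹ * meanEndNorm N p ^ (1 / p)) atTop (𝓝 0) := by
  have hp0 : 0 < p := by linarith
  have h := (SAWalk.tendsto_sum_dist₂ hp).rpow_const (p := 1 / p) (Or.inr (by positivity))
  rw [Real.zero_rpow (by positivity)] at h
  refine h.congr fun N => ?_
  rw [← SAWalk.meanEndNorm_eq, Real.div_rpow (by
    rw [SAWalk.meanEndNorm_eq]
    exact div_nonneg (Finset.sum_nonneg fun w _ => Real.rpow_nonneg (SAWalk.dist₂_nonneg w) p)
      (Nat.cast_nonneg _)) (by positivity), ← Real.rpow_mul (Nat.cast_nonneg N),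
    mul_one_div_cancel hp0.ne', Real.rpow_one]
  ring
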